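/- Fix r* ∈ (0, 1) and let κ = 3^{2/3}/2^{1/3}, t(r*) = (r*/κ)^{3/2}. There exist μ₀ > 0 and C > 0 such that for every μ ∈ (0, μ₀) there are C¹ functions R^u_{S⁺}, Θ^u_{S⁺} : ℝ/2πℤ → ℝ with the following properties. For every θ ∈ ℝ/2πℤ the solution of the planar circular restricted three-body problem in rotating polar coordinates centered at the first primary with initial condition (r, θ, R, Θ)(0) = (r*, θ, R^u_{S⁺}(θ), Θ^u_{S⁺}(θ)) is an ejection orbit: there exists t* < 0 such that the solution is defined on (t*, 0], lim_{t→t*⁺} r(t) = 0 and lim_{t→t*⁺} R(t) = +∞. Moreover, for all θ, |Θ^u_{S⁺}(θ) − μ ∫_{t(r*)}^{0} [ κ s^{2/3} sin(θ + t(r*) − s) (1 + κ² s^{4/3} − 2κ s^{2/3} cos(θ + t(r*) − s))^{−3/2} + √(2/κ) cos(θ + t(r*) − s) s^{−1/3} ] ds | ≤ Cμ². By the reversibility (r,θ,R,Θ;t) ↦ (r,−θ,−R,Θ;−t), the functions Θ^s_{S⁻}(θ) = Θ^u_{S⁺}(−θ) and R^s_{S⁻}(θ) = −R^u_{S⁺}(−θ)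 give, at the same section r = r*, initial conditions of collision orbits (r(t) → 0 and R(t) → −∞ as t increases to some t* > 0). -/

import Mathlib

open Real Filter MeasureTheory intervalIntegral
open scoped Topology

/-- The constant `κ = 3^{2/3}/2^{1/3}`. -/
noncomputable def kap : ℝ := (3 : ℝ) ^ ((2 : ℝ) / 3) / (2 : ℝ) ^ ((1 : ℝ) / 3)

/-- `t(r*) = (r*/κ)^{3/2}`. -/
noncomputable def tcol (rstar : ℝ) : ℝ := (rstar / kap) ^ ((3 : ℝ) / 2)

/-- `(r,θ,R,Θ)` is a solution of the PCRTBP with mass ratio `μ`, in rotating polar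
coordinates centered at the first primary, on the set `I` of times; i.e. it satisfies
Hamilton's equations for
`H(r,θ,R,Θ;μ) = (R²+Θ²/r²)/2 - 1/r - Θ + μ(1/r + R sin θ + (Θ/r) cos θ - (1+r²-2r cos θ)^{-1/2})`,
whose partial derivatives have been computed explicitly. -/
def IsPolarSol (μ : ℝ) (I : Set ℝ) (r θ R Θ : ℝ → ℝ) : Prop :=
  ∀ t ∈ I,
    HasDerivAt r (R t + μ * Real.sin (θ t)) t ∧
    HasDerivAt θ (Θ t / (r t) ^ 2 - 1 + μ * Real.cos (θ t) / r t) t ∧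
    HasDerivAt R ((Θ t) ^ 2 / (r t) ^ 3 - 1 / (r t) ^ 2
      + μ * (1 / (r t) ^ 2 + Θ t * Real.cos (θ t) / (r t) ^ 2
          - (r t - Real.cos (θ t)) *
            (1 + (r t) ^ 2 - 2 * r t * Real.cos (θ t)) ^ (-(3 / 2) : ℝ))) t ∧
    HasDerivAt Θ (-μ * (R t * Real.cos (θ t) - Θ t * Real.sin (θ t) / r t
      + r t * Real.sin (θ t) *
          (1 + (r t) ^ 2 - 2 * r t * Real.cos (θ t)) ^ (-(3 / 2) : ℝ))) t

/-- The integrand of the Melnikov-type integral describing `Θ^u_{S⁺}` at the section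
`r = r*`. -/
noncomputable def melCol (rstar θ s : ℝ) : ℝ :=
  kap * s ^ ((2 : ℝ) / 3) * Real.sin (θ + tcol rstar - s) *
    (1 + kap ^ 2 * s ^ ((4 : ℝ) / 3)
      - 2 * kap * s ^ ((2 : ℝ) / 3) * Real.cos (θ + tcol rstar - s)) ^ (-(3 / 2) : ℝ)
  + Real.sqrt (2 / kap) * Real.cos (θ + tcol rstar - s) * s ^ (-(1 / 3) : ℝ)

/-- A parametric integral of functions depending holomorphically on the parameter is
holomorphic, provided the integrand is uniformly bounded. -/
theorem differentiableOn_intervalIntegral_of_bounded {D : Set ℂ} (hD : IsOpen D)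
    {f : ℂ → ℝ → ℂ} {C : ℝ} (hcont : ∀ l ∈ D, Continuous (f l))
    (hdiff : ∀ s, DifferentiableOn ℂ (fun l => f l s) D)
    (hbound : ∀ l ∈ D, ∀ s ∈ Set.Icc (0 : ℝ) 1, ‖f l s‖ ≤ C) :
    DifferentiableOn ℂ (fun l => ∫ s in (0 : ℝ)..1, f l s) D := by
  intro l hl
  obtain ⟨ε, hε, hball⟩ := Metric.isOpen_iff.1 hD l hl
  have hε2 : 0 < ε / 2 := by positivity
  have hsub : ∀ l' ∈ Metric.ball l (ε / 2), Metric.closedBall l' (ε / 3) ⊆ D := by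
    intro l' hl' w hw
    apply hball
    rw [Metric.mem_ball] at *
    rw [Metric.mem_closedBall] at hw
    linarith [dist_triangle w l' l]
  have hmem : Metric.ball l (ε / 2) ⊆ D := fun l' hl' =>
    hsub l' hl' (Metric.mem_closedBall_self (by positivity))
  refine (intervalIntegral.hasDerivAt_integral_of_dominated_loc_of_deriv_le
    (F' := fun l s => deriv (fun l => f l s) l) (bound := fun _ => C / (ε / 3))
    (Metric.ball_mem_nhds l hε2) ?_ ((hcont l hl).intervalIntegrable _ _) ?_ ?_
    (by simp) ?_).2.differentiableAt.differentiableWithinAt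
  · filter_upwards [hD.mem_nhds hl] with l' hl'
    exact (hcont l' hl').aestronglyMeasurable
  · have hseq : Tendsto (fun n : ℕ => l + (ε / 4 : ℝ) / ((n : ℂ) + 1)) atTop (𝓝[≠] l) := by
      refine tendsto_nhdsWithin_iff.2 ⟨?_, Eventually.of_forall fun n => ?_⟩
      · have h1 := (tendsto_one_div_add_atTop_nhds_zero_nat (𝕜 := ℂ)).const_mul ((ε / 4 : ℝ) : ℂ)
        have h2 := h1.const_add l
        simpa [mul_one_div, div_eq_mul_inv] using h2
      · have : ((n : ℂ) + 1) ≠ 0 := by exact_mod_cast Nat.succ_ne_zero n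
        have h3 : ((ε / 4 : ℝ) : ℂ) ≠ 0 := by exact_mod_cast (by positivity : ε / 4 ≠ 0)
        simp only [Set.mem_compl_iff, Set.mem_singleton_iff, add_eq_left]
        exact div_ne_zero h3 this
    have hin : ∀ n : ℕ, l + (ε / 4 : ℝ) / ((n : ℂ) + 1) ∈ D := by
      intro n
      apply hball
      have h4 : ‖(n : ℂ) + 1‖ = n + 1 := by
        have : ((n : ℂ) + 1) = ((n + 1 : ℝ) : ℂ) := by push_cast; ring
        rw [this, Complex.norm_real, Real.norm_of_nonneg (by positivity)]
      rw [Metric.mem_ball, dist_eq_norm, add_sub_cancel_left, norm_div, h4, Complex.norm_real,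
        Real.norm_of_nonneg (by positivity), div_lt_iff₀ (by positivity)]
      nlinarith [(Nat.cast_nonneg n : (0 : ℝ) ≤ n)]
    refine aestronglyMeasurable_of_tendsto_ae (u := atTop)
      (f := fun (n : ℕ) s => slope (fun l => f l s) l (l + (ε / 4 : ℝ) / ((n : ℂ) + 1))) ?_ ?_
    · intro n
      have h5 : Continuous fun s => slope (fun l => f l s) l (l + (ε / 4 : ℝ) / ((n : ℂ) + 1)) := by
        simp only [slope, vsub_eq_sub, smul_eq_mul]
        exact continuous_const.mul ((hcont _ (hin n)).sub (hcont l hl))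
      exact h5.aestronglyMeasurable
    · refine Eventually.of_forall fun s => ?_
      exact (hasDerivAt_iff_tendsto_slope.1
        ((hdiff s).differentiableAt (hD.mem_nhds hl)).hasDerivAt).comp hseq
  · refine Eventually.of_forall fun s hs l' hl' => ?_
    rw [Set.uIoc_of_le zero_le_one] at hs
    refine Complex.norm_deriv_le_of_forall_mem_sphere_norm_le (by positivity) ?_ ?_
    · refine DifferentiableOn.diffContOnCl_ball (U := D) (hdiff s) (hsub l' hl')
    · intro w hw
      exact hbound w (hsub l' hl' (Metric.sphere_subset_closedBall hw)) s ⟨hs.1.le, hs.2⟩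
  · refine Eventually.of_forall fun s _ l' hl' => ?_
    exact ((hdiff s).differentiableAt (hD.mem_nhds (hmem hl'))).hasDerivAt

/-- A sequence of functions whose successive differences decay geometrically, uniformly on a set,
converges uniformly on that set with a geometric rate. -/
theorem exists_limit_of_geometric {α E : Type*} [NormedAddCommGroup E] [CompleteSpace E]
    {S : Set α} {u : ℕ → α → E} {C : ℝ}
    (h : ∀ n, ∀ a ∈ S, ‖u (n + 1) a - u n a‖ ≤ C * (1 / 2) ^ n) :
    ∃ v : α → E, ∀ n, ∀ a ∈ S, ‖u n a - v a‖ ≤ 2 * C * (1 / 2) ^ n := by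
  have key : ∀ a, ∃ v : E, a ∈ S → ∀ n, ‖u n a - v‖ ≤ 2 * C * (1 / 2) ^ n := by
    intro a
    by_cases ha : a ∈ S
    · have hd : ∀ n, dist (u n a) (u (n + 1) a) ≤ C * (1 / 2) ^ n := fun n => by
        rw [dist_comm, dist_eq_norm]; exact h n a ha
      obtain ⟨v, hv⟩ := cauchySeq_tendsto_of_complete
        (cauchySeq_of_le_geometric (1 / 2) C (by norm_num) hd)
      refine ⟨v, fun _ n => ?_⟩
      have := dist_le_of_le_geometric_of_tendsto (1 / 2) C (by norm_num) hd hv n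
      rw [← dist_eq_norm]
      refine this.trans_eq ?_
      ring
    · exact ⟨0, fun h => absurd h ha⟩
  choose v hv using key
  exact ⟨v, fun n a ha => hv a ha n⟩

/-- Schwarz lemma in the form used for Lipschitz estimates: a holomorphic function bounded by `M`
on the ball of radius `R` is `2M/R`-Lipschitz with respect to the centre. -/
theorem norm_sub_le_of_bounded_ball {E : Type*} [NormedAddCommGroup E] [NormedSpace ℂ E]
    {f : ℂ → E} {M R : ℝ} (hf : DifferentiableOn ℂ f (Metric.ball 0 R))
    (hM : ∀ l ∈ Metric.ball (0 : ℂ) R, ‖f l‖ ≤ M) {l : ℂ} (hl : ‖l‖ < R) :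
    ‖f l - f 0‖ ≤ 2 * M / R * ‖l‖ := by
  have hR : 0 < R := (norm_nonneg l).trans_lt hl
  have h := Complex.dist_le_div_mul_dist_of_mapsTo_ball (c := 0) (R₂ := 2 * M) hf ?_
    (z := l) (by simpa using hl)
  · simpa [dist_eq_norm] using h
  · intro w hw
    have h0 := hM 0 (Metric.mem_ball_self hR)
    rw [Metric.mem_closedBall, dist_eq_norm]
    linarith [norm_sub_le (f w) (f 0), hM w hw]

/-- The factor `1/w`, where `v = w/x` is the radial velocity at `r = x²` and energy `m e`. -/
noncomputable def invW (m : ℂ) (x : ℝ) (e : ℂ) : ℂ :=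
  (2 * (1 - m) + 2 * (x : ℂ) ^ 2 * (m * e)) ^ (-(1 / 2) : ℂ)

/-- The inverse cube of the distance to the second primary, at `r = x²`. -/
noncomputable def invDist (x : ℝ) (θ : ℂ) : ℂ :=
  (1 + (x : ℂ) ^ 4 - 2 * (x : ℂ) ^ 2 * Complex.cos θ) ^ (-(3 / 2) : ℂ)

/-- Minus the derivative of the angle with respect to `x = √r`, where `μ x⁴ g` is the angular
momentum. -/
noncomputable def rateFn (m : ℂ) (x : ℝ) (g e : ℂ) : ℂ :=
  2 * (x : ℂ) ^ 2 * (1 - m * g) * invW m x e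

/-- The source term in the equation for the angular momentum. -/
noncomputable def torqueFn (m : ℂ) (x : ℝ) (θ e : ℂ) : ℂ :=
  2 * (Complex.sin θ * (1 - invDist x θ)) * invW m x e

/-- The source term in the equation for the energy. -/
noncomputable def powerFn (m : ℂ) (x : ℝ) (θ g : ℂ) : ℂ :=
  2 * x * (m * (x : ℂ) ^ 2 * g ^ 2 - (((x : ℂ) ^ 2 - Complex.cos θ) * invDist x θ + Complex.cos θ))

/-- The quantitative conditions under which the integral operator for ejection orbits is a
contraction. -/
structure Setting (X xs δ N M m0 : ℝ) : Prop where
  xs_pos : 0 < xs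
  xs_lt : xs < X
  X_lt : X < 1
  δ_pos : 0 < δ
  m0_pos : 0 < m0
  M_pos : 0 < M
  N_eq : N = 10 * M
  dist_re : ∀ x ∈ Set.Icc 0 X, ∀ θ : ℂ, |θ.im| ≤ δ →
    0 < (1 + (x : ℂ) ^ 4 - 2 * (x : ℂ) ^ 2 * Complex.cos θ).re
  w_re : ∀ m e : ℂ, ∀ x ∈ Set.Icc 0 X, ‖m‖ ≤ m0 → ‖e‖ ≤ N →
    1 ≤ (2 * (1 - m) + 2 * (x : ℂ) ^ 2 * (m * e)).re
  rate_im : ∀ m g e : ℂ, ∀ x ∈ Set.Icc 0 X, ‖m‖ ≤ m0 → ‖g‖ ≤ N → ‖e‖ ≤ N →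
    |(rateFn m x g e).im| ≤ δ / 2
  torque_le : ∀ m e θ : ℂ, ∀ x ∈ Set.Icc 0 X, ‖m‖ ≤ m0 → ‖e‖ ≤ N → |θ.im| ≤ δ →
    ‖torqueFn m x θ e‖ ≤ M
  power_le : ∀ m g θ : ℂ, ∀ x ∈ Set.Icc 0 X, ‖m‖ ≤ m0 → ‖g‖ ≤ N → |θ.im| ≤ δ →
    ‖powerFn m x θ g‖ ≤ M

theorem norm_cos_le_cosh_im (θ : ℂ) : ‖Complex.cos θ‖ ≤ Real.cosh θ.im := by
  rw [Complex.cos, norm_div, Real.cosh_eq, Complex.norm_two]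
  gcongr
  refine (norm_add_le _ _).trans_eq ?_
  simp [Complex.norm_exp, add_comm]

theorem norm_sin_le_cosh_im (θ : ℂ) : ‖Complex.sin θ‖ ≤ Real.cosh θ.im := by
  rw [Complex.sin, norm_div, norm_mul, Complex.norm_I, mul_one, Real.cosh_eq, Complex.norm_two]
  gcongr
  refine (norm_sub_le _ _).trans_eq ?_
  simp [Complex.norm_exp]

theorem cos_re_le_cosh_im (θ : ℂ) : (Complex.cos θ).re ≤ Real.cosh θ.im :=
  (Complex.re_le_norm _).trans (norm_cos_le_cosh_im θ)

theorem norm_cpow_neg_half_le {q : ℂ} (hq : 1 ≤ q.re) : ‖q ^ (-(1 / 2) : ℂ)‖ ≤ 1 := by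
  have h : (-(1 / 2) : ℂ) = ((-(1 / 2) : ℝ) : ℂ) := by push_cast; ring
  rw [h, Complex.norm_cpow_real]
  exact Real.rpow_le_one_of_one_le_of_nonpos (hq.trans (Complex.re_le_norm _)) (by norm_num)

theorem norm_cpow_neg_three_half_le {c : ℝ} (hc : 0 < c) {q : ℂ} (hq : c ≤ q.re) :
    ‖q ^ (-(3 / 2) : ℂ)‖ ≤ c ^ (-(3 / 2) : ℝ) := by
  have h : (-(3 / 2) : ℂ) = ((-(3 / 2) : ℝ) : ℂ) := by push_cast; ring
  rw [h, Complex.norm_cpow_real]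
  exact Real.rpow_le_rpow_of_nonpos hc (hq.trans (Complex.re_le_norm _)) (by norm_num)

theorem exists_rate_threshold {ε : ℝ} (hε : 0 < ε) : ∃ η : ℝ, 0 < η ∧ η ≤ 1 ∧
    ∀ p q : ℂ, ‖p‖ ≤ η → ‖q - 2‖ ≤ η → |((1 - p) * q ^ (-(1 / 2) : ℂ)).im| ≤ ε := by
  have hcont : ContinuousAt (fun y : ℂ × ℂ => ((1 - y.1) * y.2 ^ (-(1 / 2) : ℂ)).im) (0, 2) := by
    refine Complex.continuous_im.continuousAt.comp ?_
    refine ContinuousAt.mul (by fun_prop) ?_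
    refine ContinuousAt.cpow (by fun_prop) (by fun_prop) ?_
    simp [Complex.slitPlane]
  have h0 : ((1 - (0 : ℂ)) * (2 : ℂ) ^ (-(1 / 2) : ℂ)).im = 0 := by
    have h : (2 : ℂ) ^ (-(1 / 2) : ℂ) = (((2 : ℝ) ^ (-(1 / 2) : ℝ) : ℝ) : ℂ) := by
      rw [Complex.ofReal_cpow (by norm_num)]; push_cast; rfl
    rw [h, sub_zero, one_mul, Complex.ofReal_im]
  obtain ⟨η, hη, h⟩ := Metric.continuousAt_iff.1 hcont ε hε
  refine ⟨min (η / 2) 1, by positivity, min_le_right _ _, fun p q hp hq => ?_⟩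
  have h1 : dist (p, q) ((0 : ℂ), (2 : ℂ)) < η := by
    rw [Prod.dist_eq, max_lt_iff, dist_zero_right, dist_eq_norm]
    have := min_le_left (η / 2) 1
    constructor <;> linarith
  have h2 := h h1
  rw [Real.dist_eq] at h2
  dsimp only at h2
  rw [h0, sub_zero] at h2
  exact h2.le

theorem exists_strip {K : ℝ} (hK : 0 < K) :
    ∃ δ : ℝ, 0 < δ ∧ ∀ b : ℝ, |b| ≤ δ → Real.cosh b ≤ 1 + K := by
  obtain ⟨δ, hδ, h⟩ := Metric.continuousAt_iff.1
    (Real.continuous_cosh.continuousAt (x := 0)) K hK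
  refine ⟨δ / 2, by positivity, fun b hb => ?_⟩
  have := h (x := b) (by rw [dist_zero_right, Real.norm_eq_abs]; linarith)
  rw [Real.cosh_zero, Real.dist_eq] at this
  linarith [(abs_lt.1 this).2]

theorem exists_setting {xs : ℝ} (h0 : 0 < xs) (h1 : xs < 1) :
    ∃ X δ N M m0 : ℝ, Setting X xs δ N M m0 := by
  obtain ⟨X, hX0, hX1⟩ := exists_between h1
  have hXX : 0 < 1 - X ^ 2 := by nlinarith
  set K : ℝ := (1 - X ^ 2) ^ 2 with hK
  have hKpos : 0 < K := by positivity
  have hK1 : K ≤ 1 := by rw [hK]; nlinarith [sq_nonneg X]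
  obtain ⟨δ, hδ, hcosh⟩ := exists_strip (K := K / 4) (by positivity)
  obtain ⟨η, hη, hη1, hrate⟩ := exists_rate_threshold (ε := δ / 4) (by positivity)
  set Q : ℝ := (K / 2) ^ (-(3 / 2) : ℝ) with hQ
  have hQpos : 0 < Q := by positivity
  set M : ℝ := 10 + 10 * Q with hM
  have hMpos : 0 < M := by positivity
  set N : ℝ := 10 * M with hN
  have hNpos : 0 < N := by positivity
  obtain ⟨m0, hm0, hm0'⟩ : ∃ m0 : ℝ, 0 < m0 ∧ m0 * (2 + 2 * N + N ^ 2) ≤ η := by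
    refine ⟨η / (2 + 2 * N + N ^ 2), by positivity, ?_⟩
    rw [div_mul_cancel₀]; positivity
  have hmN : m0 * N ≤ η := by nlinarith [mul_pos hm0 hNpos, mul_pos hm0 (pow_pos hNpos 2)]
  have hx2 : ∀ x ∈ Set.Icc 0 X, x ^ 2 ≤ X ^ 2 ∧ x ≤ 1 ∧ x ^ 2 ≤ 1 := by
    intro x hx
    have := hx.1
    have := hx.2
    exact ⟨by nlinarith, by linarith, by nlinarith⟩
  have hdist : ∀ x ∈ Set.Icc 0 X, ∀ θ : ℂ, |θ.im| ≤ δ →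
      K / 2 ≤ (1 + (x : ℂ) ^ 4 - 2 * (x : ℂ) ^ 2 * Complex.cos θ).re := by
    intro x hx θ hθ
    have e1 : (1 + (x : ℂ) ^ 4 - 2 * (x : ℂ) ^ 2 * Complex.cos θ).re
        = 1 + x ^ 4 - 2 * x ^ 2 * (Complex.cos θ).re := by
      have : (1 + (x : ℂ) ^ 4 - 2 * (x : ℂ) ^ 2 * Complex.cos θ)
          = ((1 + x ^ 4 : ℝ) : ℂ) - ((2 * x ^ 2 : ℝ) : ℂ) * Complex.cos θ := by push_cast; ring
      rw [this, Complex.sub_re, Complex.re_ofReal_mul, Complex.ofReal_re]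
    rw [e1]
    have e2 : (Complex.cos θ).re ≤ 1 + K / 4 :=
      (cos_re_le_cosh_im θ).trans (hcosh _ hθ)
    obtain ⟨a1, a2, a3⟩ := hx2 x hx
    have e3 : x ^ 2 * (Complex.cos θ).re ≤ x ^ 2 * (1 + K / 4) := by gcongr
    have e4 : K ≤ (1 - x ^ 2) ^ 2 := by rw [hK]; gcongr
    nlinarith [mul_nonneg (sq_nonneg x) hKpos.le]
  have hq : ∀ m e : ℂ, ∀ x ∈ Set.Icc 0 X, ‖m‖ ≤ m0 → ‖e‖ ≤ N →
      ‖(2 * (1 - m) + 2 * (x : ℂ) ^ 2 * (m * e)) - 2‖ ≤ η := by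
    intro m e x hx hm he
    have e1 : (2 * (1 - m) + 2 * (x : ℂ) ^ 2 * (m * e)) - 2
        = ((2 * x ^ 2 : ℝ) : ℂ) * (m * e) - 2 * m := by push_cast; ring
    rw [e1]
    refine (norm_sub_le _ _).trans ?_
    rw [norm_mul, norm_mul, norm_mul, Complex.norm_real, Complex.norm_two,
      Real.norm_of_nonneg (by positivity)]
    obtain ⟨a1, a2, a3⟩ := hx2 x hx
    have : ‖m‖ * ‖e‖ ≤ m0 * N := by gcongr
    have : 2 * x ^ 2 * (‖m‖ * ‖e‖) ≤ 2 * 1 * (m0 * N) := by gcongr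
    nlinarith [mul_pos hm0 (pow_pos hNpos 2)]
  have hw : ∀ m e : ℂ, ∀ x ∈ Set.Icc 0 X, ‖m‖ ≤ m0 → ‖e‖ ≤ N →
      1 ≤ (2 * (1 - m) + 2 * (x : ℂ) ^ 2 * (m * e)).re := by
    intro m e x hx hm he
    have e1 := hq m e x hx hm he
    have e2 := Complex.abs_re_le_norm ((2 * (1 - m) + 2 * (x : ℂ) ^ 2 * (m * e)) - 2)
    rw [Complex.sub_re, Complex.re_ofNat] at e2
    have := (abs_le.1 (e2.trans e1)).1
    linarith
  have hsin : ∀ θ : ℂ, |θ.im| ≤ δ → ‖Complex.sin θ‖ ≤ 2 := fun θ hθ =>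
    (norm_sin_le_cosh_im θ).trans ((hcosh _ hθ).trans (by linarith))
  have hcos : ∀ θ : ℂ, |θ.im| ≤ δ → ‖Complex.cos θ‖ ≤ 2 := fun θ hθ =>
    (norm_cos_le_cosh_im θ).trans ((hcosh _ hθ).trans (by linarith))
  have hD : ∀ x ∈ Set.Icc 0 X, ∀ θ : ℂ, |θ.im| ≤ δ → ‖invDist x θ‖ ≤ Q := fun x hx θ hθ =>
    norm_cpow_neg_three_half_le (by positivity) (hdist x hx θ hθ)
  have hxn : ∀ x ∈ Set.Icc 0 X, ‖(x : ℂ)‖ ≤ 1 := fun x hx => by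
    rw [Complex.norm_real, Real.norm_of_nonneg hx.1]; exact (hx2 x hx).2.1
  refine ⟨X, δ, N, M, m0, h0, hX0, hX1, hδ, hm0, hMpos, rfl, fun x hx θ hθ => ?_, hw, ?_, ?_, ?_⟩
  · exact (by positivity : 0 < K / 2).trans_le (hdist x hx θ hθ)
  · intro m g e x hx hm hg he
    have e1 : rateFn m x g e = ((2 * x ^ 2 : ℝ) : ℂ) *
        ((1 - m * g) * (2 * (1 - m) + 2 * (x : ℂ) ^ 2 * (m * e)) ^ (-(1 / 2) : ℂ)) := by
      rw [rateFn, invW]; push_cast; ring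
    rw [e1, Complex.im_ofReal_mul, abs_mul, abs_of_nonneg (by positivity)]
    have e2 : ‖m * g‖ ≤ η := by
      rw [norm_mul]
      exact (mul_le_mul hm hg (norm_nonneg _) hm0.le).trans hmN
    have e3 := hrate _ _ e2 (hq m e x hx hm he)
    calc _ ≤ 2 * 1 * (δ / 4) := by
          gcongr
          exact (hx2 x hx).2.2
      _ = δ / 2 := by ring
  · intro m e θ x hx hm he hθ
    rw [torqueFn, norm_mul, norm_mul, norm_mul, Complex.norm_two]
    have e1 : ‖1 - invDist x θ‖ ≤ 1 + Q :=
      (norm_sub_le _ _).trans (by rw [norm_one]; linarith [hD x hx θ hθ])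
    have e2 : ‖invW m x e‖ ≤ 1 := norm_cpow_neg_half_le (hw m e x hx hm he)
    calc _ ≤ 2 * (2 * (1 + Q)) * 1 := by
          gcongr
          exact hsin θ hθ
      _ ≤ M := by rw [hM]; linarith
  · intro m g θ x hx hm hg hθ
    rw [powerFn, norm_mul, norm_mul, Complex.norm_two]
    have e1 : ‖m * (x : ℂ) ^ 2 * g ^ 2‖ ≤ 1 := by
      rw [norm_mul, norm_mul, norm_pow, norm_pow]
      calc _ ≤ m0 * 1 ^ 2 * N ^ 2 := by
            gcongr
            exact hxn x hx
        _ ≤ 1 := by nlinarith [mul_pos hm0 hNpos, mul_pos hm0 (pow_pos hNpos 2)]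
    have e2 : ‖((x : ℂ) ^ 2 - Complex.cos θ) * invDist x θ + Complex.cos θ‖ ≤ (1 + 2) * Q + 2 := by
      refine (norm_add_le _ _).trans (add_le_add ?_ (hcos θ hθ))
      rw [norm_mul]
      refine mul_le_mul ((norm_sub_le _ _).trans (add_le_add ?_ (hcos θ hθ))) (hD x hx θ hθ)
        (norm_nonneg _) (by norm_num)
      rw [norm_pow]
      exact pow_le_one₀ (norm_nonneg _) (hxn x hx)
    calc _ ≤ 2 * 1 * (1 + ((1 + 2) * Q + 2)) := by
          gcongr
          · exact hxn x hx
          · exact (norm_sub_le _ _).trans (add_le_add e1 e2)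
      _ ≤ M := by rw [hM]; linarith

/-- Projection of the real line onto `[0, X]`. -/
noncomputable def clampTo (X x : ℝ) : ℝ := max 0 (min x X)

theorem continuous_clampTo (X : ℝ) : Continuous (clampTo X) := by
  unfold clampTo; fun_prop

theorem clampTo_of_mem {X x : ℝ} (hx : x ∈ Set.Icc 0 X) : clampTo X x = x := by
  rw [clampTo, min_eq_left hx.2, max_eq_right hx.1]

theorem clampTo_mem {X : ℝ} (hX : 0 ≤ X) (x : ℝ) : clampTo X x ∈ Set.Icc 0 X :=
  ⟨le_max_left _ _, max_le hX (min_le_right _ _)⟩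

noncomputable def rateAt (X : ℝ) (m : ℂ) (u : ℝ → ℂ × ℂ) (y : ℝ) : ℂ :=
  rateFn m (clampTo X y) (u y).1 (u y).2

/-- The angle as a function of `x = √r`, equal to `z` at `x = xs`. -/
noncomputable def angleAt (X xs : ℝ) (m z : ℂ) (u : ℝ → ℂ × ℂ) (x : ℝ) : ℂ :=
  z - ((clampTo X x - xs : ℝ) : ℂ) *
    ∫ s in (0 : ℝ)..1, rateAt X m u (xs + s * (clampTo X x - xs))

noncomputable def torqueAt (X xs : ℝ) (m z : ℂ) (u : ℝ → ℂ × ℂ) (y : ℝ) : ℂ :=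
  torqueFn m (clampTo X y) (angleAt X xs m z u y) (u y).2

noncomputable def powerAt (X xs : ℝ) (m z : ℂ) (u : ℝ → ℂ × ℂ) (y : ℝ) : ℂ :=
  powerFn m (clampTo X y) (angleAt X xs m z u y) (u y).1

/-- The integral operator whose fixed point is the pair (rescaled angular momentum, rescaled
energy) along the ejection orbit reaching `r = xs²` with angle `z`. -/
noncomputable def stepAt (X xs : ℝ) (m z : ℂ) (u : ℝ → ℂ × ℂ) (x : ℝ) : ℂ × ℂ :=
  ((clampTo X x : ℂ) * ∫ s in (0 : ℝ)..1, (s : ℂ) ^ 4 * torqueAt X xs m z u (clampTo X x * s),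
   (clampTo X x : ℂ) * ∫ s in (0 : ℝ)..1, powerAt X xs m z u (clampTo X x * s))

section Pointwise

variable {X xs δ N M m0 : ℝ} (S : Setting X xs δ N M m0)
include S

theorem Setting.X_pos : 0 < X := S.xs_pos.trans S.xs_lt

theorem Setting.N_pos : 0 < N := by rw [S.N_eq]; linarith [S.M_pos]

theorem Setting.clamp_mem (x : ℝ) : clampTo X x ∈ Set.Icc 0 X := clampTo_mem S.X_pos.le x

theorem Setting.w_slit {m e : ℂ} {x : ℝ} (hx : x ∈ Set.Icc 0 X) (hm : ‖m‖ ≤ m0) (he : ‖e‖ ≤ N) :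
    2 * (1 - m) + 2 * (x : ℂ) ^ 2 * (m * e) ∈ Complex.slitPlane :=
  Or.inl (one_pos.trans_le (S.w_re m e x hx hm he))

theorem Setting.dist_slit {θ : ℂ} {x : ℝ} (hx : x ∈ Set.Icc 0 X) (hθ : |θ.im| ≤ δ) :
    1 + (x : ℂ) ^ 4 - 2 * (x : ℂ) ^ 2 * Complex.cos θ ∈ Complex.slitPlane :=
  Or.inl (S.dist_re x hx θ hθ)

theorem Setting.norm_rate_le {m g e : ℂ} {x : ℝ} (hx : x ∈ Set.Icc 0 X) (hm : ‖m‖ ≤ m0)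
    (hg : ‖g‖ ≤ N) (he : ‖e‖ ≤ N) : ‖rateFn m x g e‖ ≤ 2 * (1 + m0 * N) := by
  have h1 : ‖invW m x e‖ ≤ 1 := norm_cpow_neg_half_le (S.w_re m e x hx hm he)
  have h2 : ‖(x : ℂ)‖ ≤ 1 := by
    rw [Complex.norm_real, Real.norm_of_nonneg hx.1]; exact hx.2.trans S.X_lt.le
  have h3 : ‖1 - m * g‖ ≤ 1 + m0 * N := by
    refine (norm_sub_le _ _).trans ?_
    rw [norm_one, norm_mul]
    have := S.m0_pos
    gcongr
  rw [rateFn, norm_mul, norm_mul, norm_mul, norm_pow, Complex.norm_two]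
  have : 0 < N := S.N_pos
  have := S.m0_pos
  calc _ ≤ 2 * 1 ^ 2 * (1 + m0 * N) * 1 := by gcongr
    _ = _ := by ring

variable {m z : ℂ} {u : ℝ → ℂ × ℂ} (hm : ‖m‖ ≤ m0) (hu : Continuous u) (hN : ∀ x, ‖u x‖ ≤ N)

include hm hu hN

theorem Setting.continuous_invW :
    Continuous fun y => invW m (clampTo X y) (u y).2 := by
  have hc := continuous_clampTo X
  refine Continuous.cpow (by fun_prop) (by fun_prop) fun y => ?_
  exact S.w_slit (S.clamp_mem y) hm ((norm_snd_le _).trans (hN y))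

theorem Setting.continuous_rateAt : Continuous (rateAt X m u) := by
  have h := S.continuous_invW hm hu hN
  have hc := continuous_clampTo X
  unfold rateAt rateFn
  exact Continuous.mul (by fun_prop) h

theorem Setting.continuous_angleAt : Continuous (angleAt X xs m z u) := by
  have h := S.continuous_rateAt hm hu hN
  have hc := continuous_clampTo X
  unfold angleAt
  refine continuous_const.sub (Continuous.mul (by fun_prop) ?_)
  refine intervalIntegral.continuous_parametric_intervalIntegral_of_continuous' ?_ _ _
  simp only [Function.uncurry_def]
  fun_prop

variable (hz : |z.im| ≤ δ / 2)
include hz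

theorem Setting.angleAt_im (x : ℝ) : |(angleAt X xs m z u x).im| ≤ δ := by
  have h := S.continuous_rateAt hm hu hN
  have hi : IntervalIntegrable (fun s => rateAt X m u (xs + s * (clampTo X x - xs)))
      volume 0 1 := Continuous.intervalIntegrable (by fun_prop) _ _
  have h1 := Complex.imCLM.intervalIntegral_comp_comm hi
  have h2 : |∫ s in (0 : ℝ)..1, (rateAt X m u (xs + s * (clampTo X x - xs))).im|
      ≤ δ / 2 * |(1 : ℝ) - 0| := by
    rw [← Real.norm_eq_abs]
    refine intervalIntegral.norm_integral_le_of_norm_le_const fun s _ => ?_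
    exact S.rate_im m _ _ _ (S.clamp_mem _) hm ((norm_fst_le _).trans (hN _))
      ((norm_snd_le _).trans (hN _))
  simp only [Complex.imCLM_apply] at h1
  rw [h1, sub_zero, abs_one, mul_one] at h2
  have h3 : |clampTo X x - xs| ≤ 1 := by
    have := S.clamp_mem x
    have := S.xs_pos
    have := S.xs_lt
    have := S.X_lt
    rw [abs_le]
    constructor <;> linarith [(S.clamp_mem x).1, (S.clamp_mem x).2]
  rw [angleAt, Complex.sub_im, Complex.im_ofReal_mul]
  refine (abs_sub _ _).trans ?_
  rw [abs_mul]
  have := mul_le_mul h3 h2 (abs_nonneg _) zero_le_one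
  linarith

theorem Setting.norm_torqueAt_le (y : ℝ) : ‖torqueAt X xs m z u y‖ ≤ M :=
  S.torque_le _ _ _ _ (S.clamp_mem y) hm ((norm_snd_le _).trans (hN _))
    (S.angleAt_im hm hu hN hz y)

theorem Setting.norm_powerAt_le (y : ℝ) : ‖powerAt X xs m z u y‖ ≤ M :=
  S.power_le _ _ _ _ (S.clamp_mem y) hm ((norm_fst_le _).trans (hN _))
    (S.angleAt_im hm hu hN hz y)

theorem Setting.continuous_invDist :
    Continuous fun y => invDist (clampTo X y) (angleAt X xs m z u y) := by
  have h := S.continuous_angleAt (z := z) hm hu hN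
  have hc := continuous_clampTo X
  refine Continuous.cpow (by fun_prop) (by fun_prop) fun y => ?_
  exact S.dist_slit (S.clamp_mem y) (S.angleAt_im hm hu hN hz y)

theorem Setting.continuous_torqueAt : Continuous (torqueAt X xs m z u) := by
  have h := S.continuous_angleAt (z := z) hm hu hN
  have h1 := S.continuous_invDist hm hu hN hz
  have h2 := S.continuous_invW hm hu hN
  unfold torqueAt torqueFn
  fun_prop

theorem Setting.continuous_powerAt : Continuous (powerAt X xs m z u) := by
  have h := S.continuous_angleAt (z := z) hm hu hN
  have h1 := S.continuous_invDist hm hu hN hz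
  have hc := continuous_clampTo X
  unfold powerAt powerFn
  fun_prop

theorem Setting.continuous_stepAt : Continuous (stepAt X xs m z u) := by
  have h := S.continuous_torqueAt hm hu hN hz
  have h1 := S.continuous_powerAt hm hu hN hz
  have hc := continuous_clampTo X
  unfold stepAt
  refine Continuous.prodMk (Continuous.mul (by fun_prop) ?_) (Continuous.mul (by fun_prop) ?_)
  all_goals
    refine intervalIntegral.continuous_parametric_intervalIntegral_of_continuous' ?_ _ _
    simp only [Function.uncurry_def]
    fun_prop

theorem Setting.norm_torque_term_le (x s : ℝ) (hs : s ∈ Set.Icc (0 : ℝ) 1) :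
    ‖(s : ℂ) ^ 4 * torqueAt X xs m z u (clampTo X x * s)‖ ≤ M := by
  rw [norm_mul, norm_pow, Complex.norm_real, Real.norm_of_nonneg hs.1]
  calc _ ≤ 1 * M := mul_le_mul (pow_le_one₀ hs.1 hs.2) (S.norm_torqueAt_le hm hu hN hz _)
        (norm_nonneg _) zero_le_one
    _ = M := one_mul _

theorem Setting.norm_stepAt_le (x : ℝ) : ‖stepAt X xs m z u x‖ ≤ M := by
  have h2 : ‖(clampTo X x : ℂ)‖ ≤ 1 := by
    rw [Complex.norm_real, Real.norm_of_nonneg (S.clamp_mem x).1]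
    exact (S.clamp_mem x).2.trans S.X_lt.le
  have key : ∀ f : ℝ → ℂ, (∀ s ∈ Set.Icc (0 : ℝ) 1, ‖f s‖ ≤ M) →
      ‖(clampTo X x : ℂ) * ∫ s in (0 : ℝ)..1, f s‖ ≤ M := by
    intro f hf
    rw [norm_mul]
    have h3 : ‖∫ s in (0 : ℝ)..1, f s‖ ≤ M * |(1 : ℝ) - 0| := by
      refine intervalIntegral.norm_integral_le_of_norm_le_const fun s hs => ?_
      rw [Set.uIoc_of_le zero_le_one] at hs
      exact hf s ⟨hs.1.le, hs.2⟩
    rw [sub_zero, abs_one, mul_one] at h3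
    calc _ ≤ 1 * M := mul_le_mul h2 h3 (norm_nonneg _) zero_le_one
      _ = M := one_mul _
  rw [stepAt, Prod.norm_def, max_le_iff]
  exact ⟨key _ fun s hs => S.norm_torque_term_le hm hu hN hz x s hs,
    key _ fun s _ => S.norm_powerAt_le hm hu hN hz _⟩

end Pointwise

/-- The integral operator maps holomorphic families to holomorphic families. -/
theorem Setting.differentiableOn_stepAt {X xs δ N M m0 : ℝ} (S : Setting X xs δ N M m0)
    {D : Set ℂ} (hD : IsOpen D) {m z : ℂ → ℂ} {u : ℂ → ℝ → ℂ × ℂ}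
    (hmd : DifferentiableOn ℂ m D) (hzd : DifferentiableOn ℂ z D)
    (hud : ∀ x, DifferentiableOn ℂ (fun l => u l x) D)
    (hm : ∀ l ∈ D, ‖m l‖ ≤ m0) (hz : ∀ l ∈ D, |(z l).im| ≤ δ / 2)
    (hu : ∀ l ∈ D, Continuous (u l)) (hN : ∀ l ∈ D, ∀ x, ‖u l x‖ ≤ N) (x : ℝ) :
    DifferentiableOn ℂ (fun l => stepAt X xs (m l) (z l) (u l) x) D := by
  have hu1 : ∀ y, DifferentiableOn ℂ (fun l => (u l y).1) D := fun y => (hud y).fst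
  have hu2 : ∀ y, DifferentiableOn ℂ (fun l => (u l y).2) D := fun y => (hud y).snd
  have hinvW : ∀ y, DifferentiableOn ℂ (fun l => invW (m l) (clampTo X y) (u l y).2) D := by
    intro y
    have := hu2 y
    refine DifferentiableOn.cpow (by fun_prop) (by fun_prop) fun l hl => ?_
    exact S.w_slit (S.clamp_mem y) (hm l hl) ((norm_snd_le _).trans (hN l hl y))
  have hrate : ∀ y, DifferentiableOn ℂ (fun l => rateAt X (m l) (u l) y) D := by
    intro y
    have := hinvW y
    have := hu1 y
    unfold rateAt rateFn
    fun_prop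
  have hangle : ∀ y, DifferentiableOn ℂ (fun l => angleAt X xs (m l) (z l) (u l) y) D := by
    intro y
    have h1 := differentiableOn_intervalIntegral_of_bounded hD
      (f := fun l s => rateAt X (m l) (u l) (xs + s * (clampTo X y - xs)))
      (C := 2 * (1 + m0 * N))
      (fun l hl => by
        have := S.continuous_rateAt (hm l hl) (hu l hl) (hN l hl)
        fun_prop)
      (fun s => hrate _)
      (fun l hl s _ => S.norm_rate_le (S.clamp_mem _) (hm l hl)
        ((norm_fst_le _).trans (hN l hl _)) ((norm_snd_le _).trans (hN l hl _)))
    unfold angleAt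
    fun_prop
  have hdist : ∀ y, DifferentiableOn ℂ
      (fun l => invDist (clampTo X y) (angleAt X xs (m l) (z l) (u l) y)) D := by
    intro y
    have := hangle y
    refine DifferentiableOn.cpow (by fun_prop) (by fun_prop) fun l hl => ?_
    exact S.dist_slit (S.clamp_mem y) (S.angleAt_im (hm l hl) (hu l hl) (hN l hl) (hz l hl) y)
  have htorque : ∀ y, DifferentiableOn ℂ (fun l => torqueAt X xs (m l) (z l) (u l) y) D := by
    intro y
    have := hdist y
    have := hangle y
    have := hinvW y
    unfold torqueAt torqueFn
    fun_prop
  have hpower : ∀ y, DifferentiableOn ℂ (fun l => powerAt X xs (m l) (z l) (u l) y) D := by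
    intro y
    have := hdist y
    have := hangle y
    have := hu1 y
    unfold powerAt powerFn
    fun_prop
  unfold stepAt
  refine DifferentiableOn.prodMk (DifferentiableOn.const_mul ?_ _)
    (DifferentiableOn.const_mul ?_ _)
  · refine differentiableOn_intervalIntegral_of_bounded hD (C := M)
      (f := fun l s => (s : ℂ) ^ 4 * torqueAt X xs (m l) (z l) (u l) (clampTo X x * s))
      (fun l hl => ?_) (fun s => (htorque _).const_mul _) fun l hl s hs => ?_
    · have := S.continuous_torqueAt (hm l hl) (hu l hl) (hN l hl) (hz l hl)
      fun_prop
    · exact S.norm_torque_term_le (hm l hl) (hu l hl) (hN l hl) (hz l hl) x s hs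
  · refine differentiableOn_intervalIntegral_of_bounded hD (C := M)
      (f := fun l s => powerAt X xs (m l) (z l) (u l) (clampTo X x * s))
      (fun l hl => ?_) (fun s => hpower _) fun l hl s hs => ?_
    · have := S.continuous_powerAt (hm l hl) (hu l hl) (hN l hl) (hz l hl)
      fun_prop
    · exact S.norm_powerAt_le (hm l hl) (hu l hl) (hN l hl) (hz l hl) _

section Contraction

variable {X xs δ N M m0 : ℝ} (S : Setting X xs δ N M m0)
include S

theorem Setting.M_le_N : M ≤ N := by rw [S.N_eq]; linarith [S.M_pos]

theorem Setting.norm_stepAt_sub_le {m z : ℂ} (hm : ‖m‖ ≤ m0) (hz : |z.im| ≤ δ / 2)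
    {u v : ℝ → ℂ × ℂ} (hu : Continuous u) (hv : Continuous v) (huM : ∀ x, ‖u x‖ ≤ M)
    (hvM : ∀ x, ‖v x‖ ≤ M) {K : ℝ} (hK : 0 < K) (huv : ∀ x, ‖u x - v x‖ ≤ K) (x : ℝ) :
    ‖stepAt X xs m z u x - stepAt X xs m z v x‖ ≤ 1 / 2 * K := by
  have hM := S.M_pos
  have hMN := S.M_le_N
  rcases le_or_gt (9 * M) K with hKM | hKM
  · refine (norm_sub_le _ _).trans ?_
    have h1 := S.norm_stepAt_le hm hu (fun x => (huM x).trans hMN) hz x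
    have h2 := S.norm_stepAt_le hm hv (fun x => (hvM x).trans hMN) hz x
    linarith
  set w : ℂ → ℝ → ℂ × ℂ := fun l y => v y + l • ((1 / K : ℝ) : ℂ) • (u y - v y) with hw
  have hd : ∀ y, ‖((1 / K : ℝ) : ℂ) • (u y - v y)‖ ≤ 1 := by
    intro y
    rw [norm_smul, Complex.norm_real, Real.norm_of_nonneg (by positivity), one_div,
      inv_mul_le_iff₀ hK, mul_one]
    exact huv y
  have hwN : ∀ l ∈ Metric.ball (0 : ℂ) (9 * M), ∀ y, ‖w l y‖ ≤ N := by
    intro l hl y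
    rw [mem_ball_zero_iff] at hl
    refine (norm_add_le _ _).trans ?_
    rw [norm_smul]
    have := mul_le_mul hl.le (hd y) (norm_nonneg _) (by positivity)
    rw [S.N_eq]
    linarith [hvM y]
  have hwc : ∀ l, Continuous (w l) := fun l => by rw [hw]; fun_prop
  have hdiff := S.differentiableOn_stepAt (D := Metric.ball (0 : ℂ) (9 * M)) Metric.isOpen_ball
    (m := fun _ => m) (z := fun _ => z) (u := w) (by fun_prop) (by fun_prop)
    (fun y => by simp only [hw]; fun_prop) (fun _ _ => hm) (fun _ _ => hz) (fun l _ => hwc l) hwN x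
  have h := norm_sub_le_of_bounded_ball hdiff
    (fun l hl => S.norm_stepAt_le hm (hwc l) (hwN l hl) hz x) (l := (K : ℂ))
    (by rwa [Complex.norm_real, Real.norm_of_nonneg hK.le])
  have e1 : w (K : ℂ) = u := by
    funext y
    have hK' : (K : ℂ) ≠ 0 := by exact_mod_cast hK.ne'
    simp [hw, smul_smul, hK']
  have e2 : w 0 = v := by funext y; simp [hw]
  rw [e1, e2, Complex.norm_real, Real.norm_of_nonneg hK.le] at h
  refine h.trans ?_
  have e3 : 2 * M / (9 * M) = 2 / 9 := by field_simp
  rw [e3]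
  linarith

theorem Setting.norm_stepAt_sub_zero_le {m z : ℂ} (hm : ‖m‖ < m0) (hz : |z.im| ≤ δ / 2)
    {u : ℝ → ℂ × ℂ} (hu : Continuous u) (huN : ∀ x, ‖u x‖ ≤ N) (x : ℝ) :
    ‖stepAt X xs m z u x - stepAt X xs 0 z u x‖ ≤ 2 * M / m0 * ‖m‖ := by
  have hball : ∀ l ∈ Metric.ball (0 : ℂ) m0, ‖l‖ ≤ m0 := fun l hl =>
    (mem_ball_zero_iff.1 hl).le
  have hdiff := S.differentiableOn_stepAt (D := Metric.ball (0 : ℂ) m0) Metric.isOpen_ball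
    (m := fun l => l) (z := fun _ => z) (u := fun _ => u) (by fun_prop) (by fun_prop)
    (fun y => by fun_prop) hball (fun _ _ => hz) (fun _ _ => hu) (fun _ _ => huN) x
  exact norm_sub_le_of_bounded_ball hdiff
    (fun l hl => S.norm_stepAt_le (hball l hl) hu huN hz x) hm

end Contraction

/-- Picard iterates of the integral operator. -/
noncomputable def iterAt (X xs : ℝ) (m : ℂ) : ℕ → ℂ → ℝ → ℂ × ℂ
  | 0 => fun _ _ => 0
  | n + 1 => fun z => stepAt X xs m z (iterAt X xs m n z)

/-- The complex strip of angles on which the ejection orbits are constructed. -/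
def strip (δ : ℝ) : Set ℂ := {z | |z.im| < δ / 2}

theorem isOpen_strip (δ : ℝ) : IsOpen (strip δ) :=
  isOpen_lt (by fun_prop) continuous_const

section Iterates

variable {X xs δ N M m0 : ℝ} (S : Setting X xs δ N M m0)
include S

theorem Setting.iterAt_spec {m : ℂ} (hm : ‖m‖ ≤ m0) (n : ℕ) :
    (∀ z ∈ strip δ, Continuous (iterAt X xs m n z) ∧ ∀ x, ‖iterAt X xs m n z x‖ ≤ M) ∧
      ∀ x, DifferentiableOn ℂ (fun z => iterAt X xs m n z x) (strip δ) := by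
  have hMN := S.M_le_N
  induction n with
  | zero =>
    refine ⟨fun z _ => ⟨continuous_const, fun x => ?_⟩, fun x => differentiableOn_const _⟩
    simpa [iterAt] using S.M_pos.le
  | succ n ih =>
    obtain ⟨ih1, ih2⟩ := ih
    have hN : ∀ z ∈ strip δ, ∀ x, ‖iterAt X xs m n z x‖ ≤ N := fun z hz x =>
      ((ih1 z hz).2 x).trans hMN
    refine ⟨fun z hz => ⟨?_, ?_⟩, fun x => ?_⟩
    · exact S.continuous_stepAt hm (ih1 z hz).1 (hN z hz) (le_of_lt hz)
    · exact S.norm_stepAt_le hm (ih1 z hz).1 (hN z hz) (le_of_lt hz)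
    · exact S.differentiableOn_stepAt (isOpen_strip δ) (m := fun _ => m) (z := fun z => z)
        (by fun_prop) (by fun_prop) ih2 (fun _ _ => hm) (fun z hz => le_of_lt hz)
        (fun z hz => (ih1 z hz).1) hN x

theorem Setting.norm_iterAt_succ_sub_le {m : ℂ} (hm : ‖m‖ ≤ m0) (n : ℕ) :
    ∀ z ∈ strip δ, ∀ x, ‖iterAt X xs m (n + 1) z x - iterAt X xs m n z x‖ ≤ M * (1 / 2) ^ n := by
  have hM := S.M_pos
  induction n with
  | zero =>
    intro z hz x
    have := ((S.iterAt_spec hm 1).1 z hz).2 x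
    simpa [iterAt] using this
  | succ n ih =>
    intro z hz x
    have h := S.norm_stepAt_sub_le hm (le_of_lt hz) ((S.iterAt_spec hm (n + 1)).1 z hz).1
      ((S.iterAt_spec hm n).1 z hz).1 ((S.iterAt_spec hm (n + 1)).1 z hz).2
      ((S.iterAt_spec hm n).1 z hz).2 (by positivity) (ih z hz) x
    refine h.trans_eq ?_
    rw [pow_succ]
    ring

/-- The integral operator has a fixed point depending holomorphically on the angle. -/
theorem Setting.exists_fixedPoint {m : ℂ} (hm : ‖m‖ ≤ m0) :
    ∃ v : ℂ → ℝ → ℂ × ℂ,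
      (∀ z ∈ strip δ, Continuous (v z) ∧ (∀ x, ‖v z x‖ ≤ M) ∧
        (∀ x, stepAt X xs m z (v z) x = v z x) ∧
        ∀ x, Tendsto (fun n => iterAt X xs m n z x) atTop (𝓝 (v z x))) ∧
      ∀ x, DifferentiableOn ℂ (fun z => v z x) (strip δ) := by
  have hM := S.M_pos
  obtain ⟨v, hv⟩ := exists_limit_of_geometric (S := strip δ ×ˢ (Set.univ : Set ℝ))
    (u := fun n (a : ℂ × ℝ) => iterAt X xs m n a.1 a.2) (C := M)
    (fun n a ha => S.norm_iterAt_succ_sub_le hm n a.1 ha.1 a.2)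
  have hgeo : Tendsto (fun n : ℕ => 2 * M * (1 / 2 : ℝ) ^ n) atTop (𝓝 0) := by
    simpa using (tendsto_pow_atTop_nhds_zero_of_lt_one (r := (1 / 2 : ℝ)) (by norm_num)
      (by norm_num)).const_mul (2 * M)
  have hv' : ∀ n, ∀ z ∈ strip δ, ∀ x, ‖iterAt X xs m n z x - v (z, x)‖ ≤ 2 * M * (1 / 2) ^ n :=
    fun n z hz x => hv n (z, x) ⟨hz, trivial⟩
  have hlim : ∀ z ∈ strip δ, ∀ x, Tendsto (fun n => iterAt X xs m n z x) atTop (𝓝 (v (z, x))) := by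
    intro z hz x
    rw [tendsto_iff_norm_sub_tendsto_zero]
    exact squeeze_zero (fun _ => norm_nonneg _) (fun n => hv' n z hz x) hgeo
  have hcont : ∀ z ∈ strip δ, Continuous fun x => v (z, x) := by
    intro z hz
    have hunif : TendstoUniformly (fun n => iterAt X xs m n z) (fun x => v (z, x)) atTop := by
      rw [Metric.tendstoUniformly_iff]
      intro ε hε
      filter_upwards [hgeo.eventually_lt_const hε] with n hn x
      rw [dist_comm, dist_eq_norm]
      exact (hv' n z hz x).trans_lt hn
    exact hunif.continuous (Frequently.of_forall fun n => ((S.iterAt_spec hm n).1 z hz).1)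
  have hbd : ∀ z ∈ strip δ, ∀ x, ‖v (z, x)‖ ≤ M := fun z hz x =>
    le_of_tendsto (hlim z hz x).norm
      (Eventually.of_forall fun n => ((S.iterAt_spec hm n).1 z hz).2 x)
  refine ⟨fun z x => v (z, x), fun z hz => ⟨hcont z hz, hbd z hz, fun x => ?_, hlim z hz⟩,
    fun x => ?_⟩
  · have h1 : Tendsto (fun n => iterAt X xs m (n + 1) z x) atTop
        (𝓝 (stepAt X xs m z (fun x => v (z, x)) x)) := by
      rw [tendsto_iff_norm_sub_tendsto_zero]
      have hgeo' := hgeo.const_mul (1 / 2)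
      rw [mul_zero] at hgeo'
      refine squeeze_zero (fun _ => norm_nonneg _) (fun n => ?_) hgeo'
      exact S.norm_stepAt_sub_le hm (le_of_lt hz) ((S.iterAt_spec hm n).1 z hz).1 (hcont z hz)
        ((S.iterAt_spec hm n).1 z hz).2 (hbd z hz) (by positivity) (hv' n z hz) x
    exact tendsto_nhds_unique h1 ((hlim z hz x).comp (tendsto_add_atTop_nat 1))
  · have hunif : TendstoUniformlyOn (fun n z => iterAt X xs m n z x) (fun z => v (z, x)) atTop
        (strip δ) := by
      rw [Metric.tendstoUniformlyOn_iff]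
      intro ε hε
      filter_upwards [hgeo.eventually_lt_const hε] with n hn z hz
      rw [dist_comm, dist_eq_norm]
      exact (hv' n z hz x).trans_lt hn
    exact hunif.tendstoLocallyUniformlyOn.differentiableOn
      (Eventually.of_forall fun n => (S.iterAt_spec hm n).2 x) (isOpen_strip δ)

end Iterates

theorem angleAt_add_two_pi (X xs : ℝ) (m z : ℂ) (u : ℝ → ℂ × ℂ) (x : ℝ) :
    angleAt X xs m (z + 2 * π) u x = angleAt X xs m z u x + 2 * π := by
  unfold angleAt; ring

theorem stepAt_add_two_pi (X xs : ℝ) (m z : ℂ) (u : ℝ → ℂ × ℂ) :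
    stepAt X xs m (z + 2 * π) u = stepAt X xs m z u := by
  have h1 : torqueAt X xs m (z + 2 * π) u = torqueAt X xs m z u := by
    funext y
    simp only [torqueAt, torqueFn, invDist, angleAt_add_two_pi, Complex.sin_add_two_pi,
      Complex.cos_add_two_pi]
  have h2 : powerAt X xs m (z + 2 * π) u = powerAt X xs m z u := by
    funext y
    simp only [powerAt, powerFn, invDist, angleAt_add_two_pi, Complex.cos_add_two_pi]
  funext x
  rw [stepAt, stepAt, h1, h2]

theorem iterAt_add_two_pi (X xs : ℝ) (m z : ℂ) (n : ℕ) :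
    iterAt X xs m n (z + 2 * π) = iterAt X xs m n z := by
  induction n with
  | zero => rfl
  | succ n ih =>
    change stepAt X xs m (z + 2 * π) (iterAt X xs m n (z + 2 * π)) =
      stepAt X xs m z (iterAt X xs m n z)
    rw [ih, stepAt_add_two_pi]

noncomputable def invWR (m x e : ℝ) : ℝ := (2 * (1 - m) + 2 * x ^ 2 * (m * e)) ^ (-(1 / 2) : ℝ)

noncomputable def invDistR (x θ : ℝ) : ℝ :=
  (1 + x ^ 4 - 2 * x ^ 2 * Real.cos θ) ^ (-(3 / 2) : ℝ)

noncomputable def rateR (X m : ℝ) (a b : ℝ → ℝ) (y : ℝ) : ℝ :=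
  2 * clampTo X y ^ 2 * (1 - m * a y) * invWR m (clampTo X y) (b y)

noncomputable def angleR (X xs m z : ℝ) (a b : ℝ → ℝ) (x : ℝ) : ℝ :=
  z - (clampTo X x - xs) * ∫ s in (0 : ℝ)..1, rateR X m a b (xs + s * (clampTo X x - xs))

noncomputable def torqueR (X xs m z : ℝ) (a b : ℝ → ℝ) (y : ℝ) : ℝ :=
  2 * (Real.sin (angleR X xs m z a b y) *
    (1 - invDistR (clampTo X y) (angleR X xs m z a b y))) * invWR m (clampTo X y) (b y)

noncomputable def powerR (X xs m z : ℝ) (a b : ℝ → ℝ) (y : ℝ) : ℝ :=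
  2 * clampTo X y * (m * clampTo X y ^ 2 * a y ^ 2 -
    ((clampTo X y ^ 2 - Real.cos (angleR X xs m z a b y)) *
      invDistR (clampTo X y) (angleR X xs m z a b y) + Real.cos (angleR X xs m z a b y)))

/-- The complexification of a pair of real functions. -/
def pairC (a b : ℝ → ℝ) (y : ℝ) : ℂ × ℂ := ((a y : ℂ), (b y : ℂ))

theorem dist_sq_nonneg (x θ : ℝ) : 0 ≤ 1 + x ^ 4 - 2 * x ^ 2 * Real.cos θ := by
  nlinarith [Real.cos_le_one θ, sq_nonneg x, sq_nonneg (1 - x ^ 2),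
    mul_nonneg (sq_nonneg x) (sub_nonneg.2 (Real.cos_le_one θ))]

theorem invDist_ofReal (x θ : ℝ) : invDist x θ = (invDistR x θ : ℂ) := by
  rw [invDist, invDistR, Complex.ofReal_cpow (dist_sq_nonneg x θ)]
  push_cast
  rfl

section RealForm

variable {X xs δ N M m0 : ℝ} (S : Setting X xs δ N M m0)
include S

theorem Setting.one_le_w {m e x : ℝ} (hm : |m| ≤ m0) (hx : x ∈ Set.Icc 0 X) (he : |e| ≤ N) :
    1 ≤ 2 * (1 - m) + 2 * x ^ 2 * (m * e) := by
  have h := S.w_re m e x hx (by simpa using hm) (by simpa using he)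
  have e1 : (2 * (1 - (m : ℂ)) + 2 * (x : ℂ) ^ 2 * (m * e)) =
    ((2 * (1 - m) + 2 * x ^ 2 * (m * e) : ℝ) : ℂ) := by push_cast; rfl
  rwa [e1, Complex.ofReal_re] at h

theorem Setting.invW_ofReal {m e x : ℝ} (hm : |m| ≤ m0) (hx : x ∈ Set.Icc 0 X) (he : |e| ≤ N) :
    invW m x e = (invWR m x e : ℂ) := by
  rw [invW, invWR, Complex.ofReal_cpow (zero_le_one.trans (S.one_le_w hm hx he))]
  push_cast
  rfl

variable {m z : ℝ} {a b : ℝ → ℝ} (hm : |m| ≤ m0) (hb : ∀ y, |b y| ≤ N)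
include hm hb

theorem Setting.angleAt_ofReal (x : ℝ) :
    angleAt X xs m z (pairC a b) x = (angleR X xs m z a b x : ℂ) := by
  have h : ∀ y, rateAt X m (pairC a b) y = (rateR X m a b y : ℂ) := by
    intro y
    simp only [rateAt, rateFn, rateR, pairC, S.invW_ofReal hm (S.clamp_mem y) (hb y)]
    push_cast
    rfl
  simp only [angleAt, angleR, h, intervalIntegral.integral_ofReal]
  push_cast
  rfl

theorem Setting.torqueAt_ofReal (y : ℝ) :
    torqueAt X xs m z (pairC a b) y = (torqueR X xs m z a b y : ℂ) := by
  simp only [torqueAt, torqueFn, torqueR, S.angleAt_ofReal hm hb, invDist_ofReal, pairC,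
    S.invW_ofReal hm (S.clamp_mem y) (hb y)]
  push_cast
  rfl

theorem Setting.powerAt_ofReal (y : ℝ) :
    powerAt X xs m z (pairC a b) y = (powerR X xs m z a b y : ℂ) := by
  simp only [powerAt, powerFn, powerR, S.angleAt_ofReal hm hb, invDist_ofReal, pairC]
  push_cast
  rfl

theorem Setting.stepAt_ofReal (x : ℝ) :
    stepAt X xs m z (pairC a b) x =
      (((clampTo X x * ∫ s in (0 : ℝ)..1, s ^ 4 * torqueR X xs m z a b (clampTo X x * s) : ℝ) : ℂ),
       ((clampTo X x * ∫ s in (0 : ℝ)..1, powerR X xs m z a b (clampTo X x * s) : ℝ) : ℂ)) := by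
  simp only [stepAt, S.torqueAt_ofReal hm hb, S.powerAt_ofReal hm hb, ← Complex.ofReal_pow,
    ← Complex.ofReal_mul, intervalIntegral.integral_ofReal]

omit hb in
theorem Setting.iterAt_real (hδ : (z : ℂ) ∈ strip δ) (n : ℕ) :
    ∃ a b : ℝ → ℝ, iterAt X xs m n z = pairC a b := by
  have hm' : ‖(m : ℂ)‖ ≤ m0 := by simpa using hm
  induction n with
  | zero => exact ⟨0, 0, by funext y; simp [iterAt, pairC]; rfl⟩
  | succ n ih =>
    obtain ⟨a, b, hab⟩ := ih
    have hb : ∀ y, |b y| ≤ N := by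
      intro y
      have h := ((S.iterAt_spec hm' n).1 z hδ).2 y
      rw [hab] at h
      have h2 := ((norm_snd_le _).trans h).trans S.M_le_N
      simpa [pairC] using h2
    refine ⟨fun x => clampTo X x *
        ∫ s in (0 : ℝ)..1, s ^ 4 * torqueR X xs m z a b (clampTo X x * s),
      fun x => clampTo X x * ∫ s in (0 : ℝ)..1, powerR X xs m z a b (clampTo X x * s), ?_⟩
    funext x
    change stepAt X xs m z (iterAt X xs m n z) x = _
    rw [hab, S.stepAt_ofReal hm hb, pairC]

end RealForm

theorem contDiff_re_of_differentiableOn_strip {δ : ℝ} (hδ : 0 < δ) {f : ℂ → ℂ}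
    (hf : DifferentiableOn ℂ f (strip δ)) : ContDiff ℝ 1 fun t : ℝ => (f t).re := by
  rw [contDiff_iff_contDiffAt]
  intro t
  have ht : (t : ℂ) ∈ strip δ := by simp [strip, hδ]
  have h1 : ContDiffAt ℝ 1 f t :=
    ((hf.contDiffOn (isOpen_strip δ)).contDiffAt ((isOpen_strip δ).mem_nhds ht)).restrict_scalars ℝ
  exact Complex.reCLM.contDiff.contDiffAt.comp t
    (h1.comp t Complex.ofRealCLM.contDiff.contDiffAt)

/-- Real form of the fixed point theorem: rescaled angular momentum `a θ` and energy `b θ` along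
the ejection orbit crossing `r = xs²` at angle `θ`. -/
theorem Setting.exists_real_solution {X xs δ N M m0 : ℝ} (S : Setting X xs δ N M m0) {m : ℝ}
    (hm : |m| < m0) :
    ∃ a b : ℝ → ℝ → ℝ,
      (∀ x, ContDiff ℝ 1 (fun z => a z x) ∧ ContDiff ℝ 1 (fun z => b z x)) ∧
      ∀ z, a (z + 2 * π) = a z ∧ b (z + 2 * π) = b z ∧
        Continuous (a z) ∧ Continuous (b z) ∧ (∀ x, |a z x| ≤ M) ∧ (∀ x, |b z x| ≤ M) ∧
        Continuous (torqueR X xs m z (a z) (b z)) ∧ Continuous (powerR X xs m z (a z) (b z)) ∧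
        Continuous (rateR X m (a z) (b z)) ∧
        (∀ x, a z x = clampTo X x *
          ∫ s in (0 : ℝ)..1, s ^ 4 * torqueR X xs m z (a z) (b z) (clampTo X x * s)) ∧
        (∀ x, b z x = clampTo X x *
          ∫ s in (0 : ℝ)..1, powerR X xs m z (a z) (b z) (clampTo X x * s)) ∧
        ∀ x, |a z x - clampTo X x *
          ∫ s in (0 : ℝ)..1, s ^ 4 * torqueR X xs 0 z (a z) (b z) (clampTo X x * s)|
            ≤ 2 * M / m0 * |m| := by
  have hm' : ‖(m : ℂ)‖ ≤ m0 := by simpa using hm.le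
  obtain ⟨v, hv, hdiff⟩ := S.exists_fixedPoint hm'
  have hstrip : ∀ z : ℝ, (z : ℂ) ∈ strip δ := fun z => by simp [strip, S.δ_pos]
  refine ⟨fun z x => (v z x).1.re, fun z x => (v z x).2.re, fun x => ⟨?_, ?_⟩, fun z => ?_⟩
  · exact contDiff_re_of_differentiableOn_strip S.δ_pos (hdiff x).fst
  · exact contDiff_re_of_differentiableOn_strip S.δ_pos (hdiff x).snd
  obtain ⟨hc, hM, hfix, hlim⟩ := hv z (hstrip z)
  have hper : v ((z + 2 * π : ℝ) : ℂ) = v z := by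
    funext x
    refine tendsto_nhds_unique ((hv _ (hstrip _)).2.2.2 x) ?_
    push_cast
    simp only [iterAt_add_two_pi]
    exact hlim x
  have hreal : v z = pairC (fun x => (v z x).1.re) (fun x => (v z x).2.re) := by
    funext x
    have h1 : ∀ n, (iterAt X xs m n z x).1.im = 0 ∧ (iterAt X xs m n z x).2.im = 0 := by
      intro n
      obtain ⟨a, b, hab⟩ := S.iterAt_real hm.le (hstrip z) n
      simp [hab, pairC]
    have h2 : (v z x).1.im = 0 := by
      refine tendsto_nhds_unique
        ((Complex.continuous_im.comp continuous_fst).continuousAt.tendsto.comp (hlim x)) ?_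
      simp only [Function.comp_def, h1]
      exact tendsto_const_nhds
    have h3 : (v z x).2.im = 0 := by
      refine tendsto_nhds_unique
        ((Complex.continuous_im.comp continuous_snd).continuousAt.tendsto.comp (hlim x)) ?_
      simp only [Function.comp_def, h1]
      exact tendsto_const_nhds
    refine Prod.ext (Complex.ext ?_ ?_) (Complex.ext ?_ ?_) <;> simp [pairC, h2, h3]
  have hN : ∀ x, ‖v z x‖ ≤ N := fun x => (hM x).trans S.M_le_N
  have hzim : |(z : ℂ).im| ≤ δ / 2 := le_of_lt (hstrip z)
  have hre : ∀ {f : ℝ → ℂ} {g : ℝ → ℝ}, Continuous f → (∀ x, f x = (g x : ℂ)) → Continuous g := by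
    intro f g hf hfg
    have : g = fun x => (f x).re := by funext x; rw [hfg, Complex.ofReal_re]
    rw [this]
    fun_prop
  have main : ∀ a b : ℝ → ℝ, v z = pairC a b →
      Continuous a ∧ Continuous b ∧ (∀ x, |a x| ≤ M) ∧ (∀ x, |b x| ≤ M) ∧
        Continuous (torqueR X xs m z a b) ∧ Continuous (powerR X xs m z a b) ∧
        Continuous (rateR X m a b) ∧
        (∀ x, a x = clampTo X x *
          ∫ s in (0 : ℝ)..1, s ^ 4 * torqueR X xs m z a b (clampTo X x * s)) ∧
        (∀ x, b x = clampTo X x *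
          ∫ s in (0 : ℝ)..1, powerR X xs m z a b (clampTo X x * s)) ∧
        ∀ x, |a x - clampTo X x *
          ∫ s in (0 : ℝ)..1, s ^ 4 * torqueR X xs 0 z a b (clampTo X x * s)|
            ≤ 2 * M / m0 * |m| := by
    intro a b hab
    have hfst : ∀ x, (v z x).1 = a x := fun x => by rw [hab, pairC]
    have hsnd : ∀ x, (v z x).2 = b x := fun x => by rw [hab, pairC]
    have hbM : ∀ x, |b x| ≤ M := fun x => by
      have h := (norm_snd_le _).trans (hM x)
      rwa [hsnd, Complex.norm_real] at h
    have hbN : ∀ x, |b x| ≤ N := fun x => (hbM x).trans S.M_le_N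
    refine ⟨hre (continuous_fst.comp hc) hfst, hre (continuous_snd.comp hc) hsnd, ?_, hbM,
      hre (S.continuous_torqueAt hm' hc hN hzim) fun x => ?_,
      hre (S.continuous_powerAt hm' hc hN hzim) fun x => ?_,
      hre (S.continuous_rateAt hm' hc hN) fun x => ?_, fun x => ?_, fun x => ?_, fun x => ?_⟩
    · intro x
      have h := (norm_fst_le _).trans (hM x)
      rwa [hfst, Complex.norm_real] at h
    · rw [hab, S.torqueAt_ofReal hm.le hbN]
    · rw [hab, S.powerAt_ofReal hm.le hbN]
    · simp only [rateAt, rateFn, rateR, hab, pairC, S.invW_ofReal hm.le (S.clamp_mem x) (hbN x)]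
      push_cast
      rfl
    · have h := hfix x
      rw [hab, S.stepAt_ofReal hm.le hbN] at h
      exact (Complex.ofReal_injective (congrArg Prod.fst h)).symm
    · have h := hfix x
      rw [hab, S.stepAt_ofReal hm.le hbN] at h
      exact (Complex.ofReal_injective (congrArg Prod.snd h)).symm
    · have h := S.norm_stepAt_sub_zero_le (m := (m : ℂ)) (by simpa using hm) hzim hc hN x
      rw [hfix, hab, ← Complex.ofReal_zero,
        S.stepAt_ofReal (m := 0) (by simpa using S.m0_pos.le) hbN, pairC] at h
      have h2 := (norm_fst_le _).trans h
      rw [Prod.fst_sub, ← Complex.ofReal_sub, Complex.norm_real, Complex.norm_real] at h2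
      exact h2
  refine ⟨?_, ?_, main _ _ hreal⟩
  · funext x
    simp only [hper]
  · funext x
    simp only [hper]

theorem exists_time_inverse {X xs : ℝ} {q : ℝ → ℝ} (hq : Continuous q)
    (hpos : ∀ x ∈ Set.Ioo 0 X, 0 < q x) (h0 : 0 < xs) (hX : xs < X) :
    ∃ tstar < 0, ∃ ξ : ℝ → ℝ, ξ 0 = xs ∧
      (∀ t ∈ Set.Ioc tstar 0, ξ t ∈ Set.Ioo 0 X ∧ HasDerivAt ξ (q (ξ t))⁻¹ t) ∧
      Tendsto ξ (𝓝[>] tstar) (𝓝[>] 0) := by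
  set T : ℝ → ℝ := fun x => ∫ y in xs..x, q y with hT
  have hder : ∀ x, HasStrictDerivAt T (q x) x := fun x => hq.integral_hasStrictDerivAt xs x
  have hcont : Continuous T := continuous_iff_continuousAt.2 fun x => (hder x).hasDerivAt.continuousAt
  have hmono : StrictMonoOn T (Set.Icc 0 X) := by
    refine strictMonoOn_of_deriv_pos (convex_Icc 0 X) hcont.continuousOn fun x hx => ?_
    rw [interior_Icc] at hx
    rw [(hder x).hasDerivAt.deriv]
    exact hpos x hx
  have hinv : Set.LeftInvOn (Function.invFunOn T (Set.Ioo 0 X)) T (Set.Ioo 0 X) :=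
    (hmono.injOn.mono Set.Ioo_subset_Icc_self).leftInvOn_invFunOn
  set ξ := Function.invFunOn T (Set.Ioo 0 X)
  have hTxs : T xs = 0 := by simp [hT]
  have hsub : ∀ {c}, 0 < c → c < X → ∀ t ∈ Set.Ioc (T 0) (T c), ξ t ∈ Set.Ioc 0 c ∧ T (ξ t) = t := by
    intro c hc hcX t ht
    obtain ⟨x, hx, rfl⟩ := intermediate_value_Ioc hc.le hcont.continuousOn ht
    rw [hinv ⟨hx.1, hx.2.trans_lt hcX⟩]
    exact ⟨hx, rfl⟩
  refine ⟨T 0, ?_, ξ, ?_, fun t ht => ?_, ?_⟩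
  · exact (hmono ⟨le_rfl, (h0.trans hX).le⟩ ⟨h0.le, hX.le⟩ h0).trans_eq hTxs
  · rw [← hTxs, hinv ⟨h0, hX⟩]
  · obtain ⟨h1, h2⟩ := hsub h0 hX t (by rwa [hTxs])
    have h3 : ξ t ∈ Set.Ioo 0 X := ⟨h1.1, h1.2.trans_lt hX⟩
    refine ⟨h3, ?_⟩
    have h4 := (hder (ξ t)).to_local_left_inverse (hpos _ h3).ne'
      (Filter.eventually_of_mem (isOpen_Ioo.mem_nhds h3) fun x hx => hinv hx)
    rw [h2] at h4
    exact h4.hasDerivAt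
  · refine tendsto_nhdsWithin_iff.2 ⟨?_, ?_⟩
    · rw [Metric.tendsto_nhds]
      intro ε hε
      have hc : 0 < min (ε / 2) xs := lt_min (half_pos hε) h0
      have hcX : min (ε / 2) xs < X := (min_le_right _ _).trans_lt hX
      filter_upwards [Ioc_mem_nhdsGT
        (hmono ⟨le_rfl, (h0.trans hX).le⟩ ⟨hc.le, hcX.le⟩ hc)] with t ht
      obtain ⟨h1, -⟩ := hsub hc hcX t ht
      rw [Real.dist_eq, sub_zero, abs_of_pos h1.1]
      linarith [h1.2.trans (min_le_left _ _)]
    · filter_upwards [Ioc_mem_nhdsGT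
        (hmono ⟨le_rfl, (h0.trans hX).le⟩ ⟨h0.le, hX.le⟩ h0)] with t ht
      exact (hsub h0 hX t ht).1.1

/-- A solution of the equations of motion with independent variable `x = √r` gives, after a change
of time, an ejection orbit. -/
theorem exists_ejection_of_profile {X xs m : ℝ} {φ a b W q : ℝ → ℝ} (h0 : 0 < xs) (hX : xs < X)
    (hq : Continuous q) (hqW : ∀ x ∈ Set.Ioo 0 X, q x = 2 * x ^ 2 / √(W x))
    (hW : ∀ x, W x = 2 * (1 - m) + 2 * x ^ 2 * (m * b x))
    (hW1 : ∀ x ∈ Set.Ioo 0 X, 1 ≤ W x)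
    (hφ : ∀ x ∈ Set.Ioo 0 X, HasDerivAt φ (-(2 * x ^ 2 * (1 - m * a x) / √(W x))) x)
    (ha : ∀ x ∈ Set.Ioo 0 X, HasDerivAt (fun y => y ^ 4 * a y)
      (x ^ 4 * (2 * (Real.sin (φ x) * (1 - invDistR x (φ x))) / √(W x))) x)
    (hb : ∀ x ∈ Set.Ioo 0 X, HasDerivAt b (2 * x * (m * x ^ 2 * a x ^ 2 -
      ((x ^ 2 - Real.cos (φ x)) * invDistR x (φ x) + Real.cos (φ x)))) x) :
    ∃ tstar < 0, ∃ r θ R Θ : ℝ → ℝ, IsPolarSol m (Set.Ioc tstar 0) r θ R Θ ∧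
      r 0 = xs ^ 2 ∧ θ 0 = φ xs ∧ R 0 = √(W xs) / xs - m * Real.sin (φ xs) ∧
      Θ 0 = m * (xs ^ 4 * a xs) - m * (xs ^ 2 * Real.cos (φ xs)) ∧
      Tendsto r (𝓝[>] tstar) (𝓝 0) ∧ Tendsto R (𝓝[>] tstar) atTop := by
  have hs : ∀ x ∈ Set.Ioo 0 X, 0 < √(W x) := fun x hx =>
    Real.sqrt_pos.2 (zero_lt_one.trans_le (hW1 x hx))
  obtain ⟨tstar, ht0, ξ, hξ0, hξ, hlim⟩ := exists_time_inverse hq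
    (fun x hx => by rw [hqW x hx]; exact div_pos (by nlinarith [hx.1]) (hs x hx)) h0 hX
  refine ⟨tstar, ht0, fun t => ξ t ^ 2, fun t => φ (ξ t),
    fun t => √(W (ξ t)) / ξ t - m * Real.sin (φ (ξ t)),
    fun t => m * (ξ t ^ 4 * a (ξ t)) - m * (ξ t ^ 2 * Real.cos (φ (ξ t))), ?_,
    by simp only [hξ0], by simp only [hξ0], by simp only [hξ0], by simp only [hξ0], ?_, ?_⟩
  · intro t ht
    obtain ⟨hx, hξd⟩ := hξ t ht
    have hx0 := hx.1.ne'
    have hsp := hs _ hx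
    have hs0 := hsp.ne'
    have hs2 : √(W (ξ t)) ^ 2 = W (ξ t) := Real.sq_sqrt (zero_le_one.trans (hW1 _ hx))
    rw [hqW _ hx, inv_div] at hξd
    have hWd : HasDerivAt W (4 * ξ t * (m * b (ξ t)) + 2 * ξ t ^ 2 * (m * (2 * ξ t *
        (m * ξ t ^ 2 * a (ξ t) ^ 2 - ((ξ t ^ 2 - Real.cos (φ (ξ t))) *
          invDistR (ξ t) (φ (ξ t)) + Real.cos (φ (ξ t))))))) (ξ t) := by
      have h := (((hasDerivAt_pow 2 (ξ t)).const_mul 2).mul ((hb _ hx).const_mul m)).const_add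
        (2 * (1 - m))
      refine (h.congr_deriv ?_).congr_of_eventuallyEq (Filter.Eventually.of_forall hW)
      push_cast
      ring
    have hD : invDistR (ξ t) (φ (ξ t)) =
        (1 + (ξ t ^ 2) ^ 2 - 2 * ξ t ^ 2 * Real.cos (φ (ξ t))) ^ (-(3 / 2) : ℝ) := by
      rw [invDistR]; ring_nf
    have hθd : HasDerivAt (fun t => φ (ξ t)) (m * a (ξ t) - 1) t := by
      refine ((hφ _ hx).comp t hξd).congr_deriv ?_
      field_simp
      ring
    have hrd : HasDerivAt (fun t => ξ t ^ 2) (√(W (ξ t)) / ξ t) t := by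
      refine (hξd.pow 2).congr_deriv ?_
      push_cast
      field_simp
    have hvd : HasDerivAt (fun t => √(W (ξ t)) / ξ t) (m ^ 2 * ξ t ^ 2 * a (ξ t) ^ 2 -
        (1 - m) / ξ t ^ 4 - m * ((ξ t ^ 2 - Real.cos (φ (ξ t))) *
          invDistR (ξ t) (φ (ξ t)) + Real.cos (φ (ξ t)))) t := by
      have h := (((hWd.comp t hξd).sqrt (zero_lt_one.trans_le (hW1 _ hx)).ne').div hξd hx0)
      refine h.congr_deriv ?_
      simp only [Function.comp]
      field_simp
      rw [hs2, hW]
      ring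
    have hGd : HasDerivAt (fun t => ξ t ^ 4 * a (ξ t))
        (ξ t ^ 2 * (Real.sin (φ (ξ t)) * (1 - invDistR (ξ t) (φ (ξ t))))) t := by
      refine ((ha _ hx).comp t hξd).congr_deriv ?_
      field_simp
    refine ⟨hrd.congr_deriv (by ring), hθd.congr_deriv ?_,
      (hvd.sub (hθd.sin.const_mul m)).congr_deriv ?_,
      ((hGd.const_mul m).sub ((hrd.mul hθd.cos).const_mul m)).congr_deriv ?_⟩
    · field_simp
      ring
    · rw [← hD]
      field_simp
      ring
    · rw [← hD]
      field_simp
      ring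
  · have h := (hlim.mono_right nhdsWithin_le_nhds).pow 2
    simpa using h
  · have h1 : Tendsto (fun t => (ξ t)⁻¹ - |m|) (𝓝[>] tstar) atTop :=
      tendsto_atTop_add_const_right _ _ (tendsto_inv_nhdsGT_zero.comp hlim)
    refine tendsto_atTop_mono' _ ?_ h1
    filter_upwards [Ioc_mem_nhdsGT ht0] with t ht
    obtain ⟨hx, -⟩ := hξ t ht
    have h2 : 1 ≤ √(W (ξ t)) := Real.one_le_sqrt.2 (hW1 _ hx)
    have h3 : (ξ t)⁻¹ ≤ √(W (ξ t)) / ξ t := by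
      rw [inv_eq_one_div]
      exact div_le_div_of_nonneg_right h2 hx.1.le
    have h4 : m * Real.sin (φ (ξ t)) ≤ |m| := by
      refine (le_abs_self _).trans ?_
      rw [abs_mul]
      exact mul_le_of_le_one_right (abs_nonneg m) (Real.abs_sin_le_one _)
    linarith

theorem clampTo_mul_integral {X x : ℝ} (hx : x ∈ Set.Icc 0 X) (f : ℝ → ℝ) :
    clampTo X x * ∫ s in (0 : ℝ)..1, f (clampTo X x * s) = ∫ y in (0 : ℝ)..x, f y := by
  rw [clampTo_of_mem hx, intervalIntegral.mul_integral_comp_mul_left, mul_zero, mul_one]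

theorem pow_four_mul_clampTo_mul_integral {X x : ℝ} (hx : x ∈ Set.Icc 0 X) (f : ℝ → ℝ) :
    x ^ 4 * (clampTo X x * ∫ s in (0 : ℝ)..1, s ^ 4 * f (clampTo X x * s)) =
      ∫ y in (0 : ℝ)..x, y ^ 4 * f y := by
  have h := clampTo_mul_integral hx fun y => y ^ 4 * f y
  rw [← h, mul_left_comm, ← intervalIntegral.integral_const_mul, clampTo_of_mem hx]
  simp only [mul_pow, mul_assoc]

theorem angleR_of_mem {X xs m z x : ℝ} {a b : ℝ → ℝ} (hx : x ∈ Set.Icc 0 X) :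
    angleR X xs m z a b x = z - ∫ y in xs..x, rateR X m a b y := by
  have h := intervalIntegral.mul_integral_comp_add_mul (a := 0) (b := 1)
    (f := rateR X m a b) (c := x - xs) xs
  rw [angleR, clampTo_of_mem hx]
  simp only [mul_comm _ (x - xs)]
  rw [h]
  ring_nf

theorem hasDerivAt_of_eqOn_integral {X c x K : ℝ} {F f : ℝ → ℝ} (hf : Continuous f)
    (hx : x ∈ Set.Ioo 0 X) (hF : ∀ y ∈ Set.Icc 0 X, F y = K + ∫ s in c..y, f s) :
    HasDerivAt F (f x) x :=
  ((hf.integral_hasStrictDerivAt c x).hasDerivAt.const_add K).congr_of_eventuallyEq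
    (Filter.eventually_of_mem (Icc_mem_nhds hx.1 hx.2) hF)

theorem Setting.exists_ejection {X xs δ N M m0 : ℝ} (S : Setting X xs δ N M m0) {m z : ℝ}
    (hm : |m| ≤ m0) {a b : ℝ → ℝ} (hbc : Continuous b)
    (hbM : ∀ x, |b x| ≤ M) (htc : Continuous (torqueR X xs m z a b))
    (hpc : Continuous (powerR X xs m z a b)) (hrc : Continuous (rateR X m a b))
    (ha : ∀ x, a x = clampTo X x *
      ∫ s in (0 : ℝ)..1, s ^ 4 * torqueR X xs m z a b (clampTo X x * s))
    (hb : ∀ x, b x = clampTo X x *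
      ∫ s in (0 : ℝ)..1, powerR X xs m z a b (clampTo X x * s)) :
    ∃ tstar < 0, ∃ r θ R Θ : ℝ → ℝ, IsPolarSol m (Set.Ioc tstar 0) r θ R Θ ∧
      r 0 = xs ^ 2 ∧ θ 0 = z ∧
      R 0 = √(2 * (1 - m) + 2 * xs ^ 2 * (m * b xs)) / xs - m * Real.sin z ∧
      Θ 0 = m * (xs ^ 4 * a xs) - m * (xs ^ 2 * Real.cos z) ∧
      Tendsto r (𝓝[>] tstar) (𝓝 0) ∧ Tendsto R (𝓝[>] tstar) atTop := by
  have hbN : ∀ x, |b x| ≤ N := fun x => (hbM x).trans S.M_le_N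
  have hW1 : ∀ x ∈ Set.Icc 0 X, 1 ≤ 2 * (1 - m) + 2 * x ^ 2 * (m * b x) :=
    fun x hx => S.one_le_w hm hx (hbN x)
  have hinv : ∀ x ∈ Set.Icc 0 X, invWR m x (b x) = (√(2 * (1 - m) + 2 * x ^ 2 * (m * b x)))⁻¹ := by
    intro x hx
    rw [invWR, Real.rpow_neg (zero_le_one.trans (hW1 x hx)), Real.sqrt_eq_rpow]
  have hxs : xs ∈ Set.Icc 0 X := ⟨S.xs_pos.le, S.xs_lt.le⟩
  have hangle : angleR X xs m z a b xs = z := by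
    rw [angleR_of_mem hxs, intervalIntegral.integral_same, sub_zero]
  have hq : Continuous fun x => 2 * clampTo X x ^ 2 * invWR m (clampTo X x) (b x) := by
    have hcl := continuous_clampTo X
    have hne : ∀ x, 2 * (1 - m) + 2 * clampTo X x ^ 2 * (m * b x) ≠ 0 := fun x =>
      (zero_lt_one.trans_le (S.one_le_w hm (S.clamp_mem x) (hbN x))).ne'
    unfold invWR
    exact (by fun_prop : Continuous fun x => 2 * clampTo X x ^ 2).mul
      (Continuous.rpow_const (by fun_prop) fun x => Or.inl (hne x))
  have main := exists_ejection_of_profile (m := m) (φ := angleR X xs m z a b) (a := a) (b := b)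
    (W := fun x => 2 * (1 - m) + 2 * x ^ 2 * (m * b x)) S.xs_pos S.xs_lt hq
    (fun x hx => by
      have hx' := Set.Ioo_subset_Icc_self hx
      simp only [clampTo_of_mem hx', hinv x hx', div_eq_mul_inv])
    (fun x => rfl) (fun x hx => hW1 x (Set.Ioo_subset_Icc_self hx))
    (fun x hx => by
      have hx' := Set.Ioo_subset_Icc_self hx
      refine (hasDerivAt_of_eqOn_integral (K := z) (c := xs) hrc.neg hx fun y hy => ?_).congr_deriv ?_
      · rw [angleR_of_mem hy]
        simp only [Pi.neg_apply, intervalIntegral.integral_neg, sub_eq_add_neg]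
      · simp only [Pi.neg_apply, rateR, clampTo_of_mem hx', hinv x hx', div_eq_mul_inv])
    (fun x hx => by
      have hx' := Set.Ioo_subset_Icc_self hx
      refine (hasDerivAt_of_eqOn_integral (K := 0) (c := 0)
        ((continuous_id.pow 4).mul htc) hx fun y hy => ?_).congr_deriv ?_
      · rw [ha, pow_four_mul_clampTo_mul_integral hy, zero_add]
        rfl
      · simp only [Pi.mul_apply, Pi.pow_apply, id, torqueR, clampTo_of_mem hx', hinv x hx',
          div_eq_mul_inv])
    (fun x hx => by
      have hx' := Set.Ioo_subset_Icc_self hx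
      refine (hasDerivAt_of_eqOn_integral (K := 0) (c := 0) hpc hx fun y hy => ?_).congr_deriv ?_
      · rw [hb, clampTo_mul_integral hy, zero_add]
      · simp only [powerR, clampTo_of_mem hx'])
  simpa only [hangle] using main

theorem IsPolarSol.reverse {m tstar : ℝ} {r θ R Θ : ℝ → ℝ}
    (h : IsPolarSol m (Set.Ioc tstar 0) r θ R Θ) :
    IsPolarSol m (Set.Ico 0 (-tstar)) (fun t => r (-t)) (fun t => -θ (-t)) (fun t => -R (-t))
      (fun t => Θ (-t)) := by
  intro t ht
  obtain ⟨h1, h2, h3, h4⟩ := h (-t) ⟨by linarith [ht.2], by linarith [ht.1]⟩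
  have hn := hasDerivAt_neg t
  refine ⟨(h1.comp t hn).congr_deriv ?_, (h2.comp t hn).neg.congr_deriv ?_,
    (h3.comp t hn).neg.congr_deriv ?_, (h4.comp t hn).congr_deriv ?_⟩ <;>
  · simp only [Real.sin_neg, Real.cos_neg]
    ring

theorem kap_pos : 0 < kap := by unfold kap; positivity

theorem kap_pow_three : kap ^ 3 = 9 / 2 := by
  rw [kap, div_pow, ← Real.rpow_natCast, ← Real.rpow_natCast, ← Real.rpow_mul (by norm_num),
    ← Real.rpow_mul (by norm_num)]
  norm_num

theorem tcol_sq {x : ℝ} (hx : 0 ≤ x) : tcol (x ^ 2) = √2 / 3 * x ^ 3 := by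
  have hk := kap_pos
  have h0 : 0 ≤ x ^ 2 / kap := by positivity
  rw [tcol, ← pow_left_inj₀ (by positivity) (by positivity) two_ne_zero, ← Real.rpow_natCast,
    ← Real.rpow_mul h0, mul_pow, div_pow, Real.sq_sqrt zero_le_two]
  norm_num
  rw [div_pow, kap_pow_three]
  ring

theorem kap_mul_rpow {y : ℝ} (hy : 0 ≤ y) : kap * (√2 / 3 * y ^ 3) ^ ((2 : ℝ) / 3) = y ^ 2 := by
  have hk := kap_pos
  have h0 : 0 ≤ √2 / 3 * y ^ 3 := by positivity
  rw [← pow_left_inj₀ (by positivity) (by positivity) three_ne_zero, mul_pow, kap_pow_three,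
    ← Real.rpow_natCast, ← Real.rpow_mul h0]
  norm_num
  rw [mul_pow, div_pow, Real.sq_sqrt zero_le_two]
  ring

theorem sqrt_kap_mul_rpow {y : ℝ} (hy : 0 < y) :
    √(2 / kap) * (√2 / 3 * y ^ 3) ^ (-(1 / 3) : ℝ) = √2 / y := by
  have hk := kap_pos
  have h0 : 0 ≤ √2 / 3 * y ^ 3 := by positivity
  have h1 : √(2 / kap) ^ 6 = 16 / 9 := by
    rw [show √(2 / kap) ^ 6 = (√(2 / kap) ^ 2) ^ 3 by ring, Real.sq_sqrt (by positivity), div_pow, kap_pow_three]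
    norm_num
  have h2 : ((√2 / 3 * y ^ 3) ^ (-(1 / 3) : ℝ)) ^ 6 = ((√2 / 3 * y ^ 3) ^ 2)⁻¹ := by
    generalize √2 / 3 * y ^ 3 = c at h0
    rw [← Real.rpow_natCast, ← Real.rpow_mul h0, ← Real.rpow_natCast, ← Real.rpow_neg h0]
    norm_num
  have h3 : √2 ^ 6 = 8 := by
    rw [show √2 ^ 6 = (√2 ^ 2) ^ 3 by ring, Real.sq_sqrt zero_le_two]
    norm_num
  rw [← pow_left_inj₀ (by positivity) (by positivity) (by norm_num : 6 ≠ 0), mul_pow, h1, h2,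
    div_pow, h3, mul_pow, div_pow, Real.sq_sqrt zero_le_two]
  field_simp
  norm_num

/-- The angle along the ejection orbit of the unperturbed problem. -/
noncomputable def angleKepler (xs θ y : ℝ) : ℝ := θ - √2 / 3 * (y ^ 3 - xs ^ 3)

theorem melCol_comp {xs y : ℝ} (hxs : 0 ≤ xs) (hy : 0 < y) (θ : ℝ) :
    melCol (xs ^ 2) θ (√2 / 3 * y ^ 3) =
      y ^ 2 * Real.sin (angleKepler xs θ y) * invDistR y (angleKepler xs θ y) +
        √2 / y * Real.cos (angleKepler xs θ y) := by
  have h0 : 0 ≤ √2 / 3 * y ^ 3 := by positivity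
  have hang : θ + tcol (xs ^ 2) - √2 / 3 * y ^ 3 = angleKepler xs θ y := by
    rw [tcol_sq hxs, angleKepler]; ring
  have h4 : kap ^ 2 * (√2 / 3 * y ^ 3) ^ ((4 : ℝ) / 3) = y ^ 4 := by
    have h : (√2 / 3 * y ^ 3) ^ ((4 : ℝ) / 3) = ((√2 / 3 * y ^ 3) ^ ((2 : ℝ) / 3)) ^ 2 := by
      generalize √2 / 3 * y ^ 3 = c at h0
      rw [← Real.rpow_natCast, ← Real.rpow_mul h0]
      norm_num
    rw [h, ← mul_pow, kap_mul_rpow hy.le]; ring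
  rw [melCol, hang, h4, mul_assoc 2 kap, kap_mul_rpow hy.le, ← sqrt_kap_mul_rpow hy, invDistR]
  ring

theorem image_mul_pow_three {c xs : ℝ} (hc : 0 < c) (hxs : 0 ≤ xs) :
    (fun y => c * y ^ 3) '' Set.Ioc 0 xs = Set.Ioc 0 (c * xs ^ 3) := by
  refine Set.Subset.antisymm ?_ fun t ht => ?_
  · rintro _ ⟨y, hy, rfl⟩
    have := hy.1
    exact ⟨by positivity, mul_le_mul_of_nonneg_left (pow_le_pow_left₀ hy.1.le hy.2 3) hc.le⟩
  · exact intermediate_value_Ioc (f := fun y => c * y ^ 3) hxs (by fun_prop) (by simpa using ht)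

theorem integral_melCol {xs : ℝ} (h0 : 0 < xs) (h1 : xs < 1) (θ : ℝ) :
    ∫ s in tcol (xs ^ 2)..0, melCol (xs ^ 2) θ s =
      (∫ y in (0 : ℝ)..xs, y ^ 4 * (√2 * (Real.sin (angleKepler xs θ y) *
        (1 - invDistR y (angleKepler xs θ y))))) - xs ^ 2 * Real.cos θ := by
  set φ := angleKepler xs θ with hφ
  have h23 : 0 < √2 / 3 := by positivity
  have hφd : ∀ y, HasDerivAt φ (-(√2 * y ^ 2)) y := by
    intro y
    refine ((((hasDerivAt_pow 3 y).sub_const (xs ^ 3)).const_mul (√2 / 3)).const_sub θ).congr_deriv ?_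
    push_cast
    ring
  have hφc : Continuous φ := continuous_iff_continuousAt.2 fun y => (hφd y).continuousAt
  have hfd : ∀ y, HasDerivAt (fun y => √2 / 3 * y ^ 3) (√2 * y ^ 2) y := by
    intro y
    refine ((hasDerivAt_pow 3 y).const_mul (√2 / 3)).congr_deriv ?_
    push_cast
    ring
  have hchange : ∫ s in tcol (xs ^ 2)..0, melCol (xs ^ 2) θ s =
      -∫ y in (0 : ℝ)..xs, (y ^ 4 * (√2 * (Real.sin (φ y) * invDistR y (φ y))) +
        2 * y * Real.cos (φ y)) := by
    rw [intervalIntegral.integral_symm, tcol_sq h0.le,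
      intervalIntegral.integral_of_le (by positivity), intervalIntegral.integral_of_le h0.le,
      ← image_mul_pow_three h23 h0.le,
      integral_image_eq_integral_abs_deriv_smul measurableSet_Ioc
        (f' := fun y => √2 * y ^ 2) (fun y _ => (hfd y).hasDerivWithinAt) ?_]
    · congr 1
      refine setIntegral_congr_fun measurableSet_Ioc fun y hy => ?_
      have hy0 := hy.1
      have h2 : √2 * √2 = 2 := Real.mul_self_sqrt zero_le_two
      simp only [melCol_comp h0.le hy0, smul_eq_mul]
      rw [abs_of_nonneg (by positivity), ← hφ]
      field_simp
      linear_combination Real.cos (φ y) * h2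
    · intro x hx y hy hxy
      exact (pow_left_inj₀ hx.1.le hy.1.le three_ne_zero).1 (mul_left_cancel₀ h23.ne' hxy)
  have hboundary : ∫ y in (0 : ℝ)..xs, (2 * y * Real.cos (φ y) + y ^ 4 * (√2 * Real.sin (φ y))) =
      xs ^ 2 * Real.cos θ := by
    rw [intervalIntegral.integral_eq_sub_of_hasDerivAt (f := fun y => y ^ 2 * Real.cos (φ y))]
    · simp [hφ, angleKepler]
    · intro y _
      refine ((hasDerivAt_pow 2 y).mul (hφd y).cos).congr_deriv ?_
      push_cast
      ring
    · exact Continuous.intervalIntegrable (by fun_prop) _ _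
  have hD : ContinuousOn (fun y => invDistR y (φ y)) (Set.uIcc 0 xs) := by
    refine ContinuousOn.rpow_const (by fun_prop) fun y hy => Or.inl ?_
    rw [Set.uIcc_of_le h0.le] at hy
    have hy1 : 0 < 1 - y ^ 2 := by nlinarith [hy.1, hy.2]
    nlinarith [mul_nonneg (sq_nonneg y) (sub_nonneg.2 (Real.cos_le_one (φ y))), pow_pos hy1 2]
  rw [hchange, ← hboundary, ← intervalIntegral.integral_sub, ← intervalIntegral.integral_neg]
  · refine intervalIntegral.integral_congr fun y _ => ?_
    ring
  · exact ContinuousOn.intervalIntegrable (by fun_prop)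
  · exact Continuous.intervalIntegrable (by fun_prop) _ _

theorem two_mul_rpow_neg_half : 2 * (2 : ℝ) ^ (-(1 / 2) : ℝ) = √2 := by
  rw [Real.rpow_neg zero_le_two, ← Real.sqrt_eq_rpow]
  field_simp
  norm_num

theorem angleR_zero {X xs z y : ℝ} (a b : ℝ → ℝ) (hxs : xs ∈ Set.Icc 0 X)
    (hy : y ∈ Set.Icc 0 X) : angleR X xs 0 z a b y = angleKepler xs z y := by
  have h : ∫ s in xs..y, rateR X 0 a b s = ∫ s in xs..y, √2 * s ^ 2 := by
    refine intervalIntegral.integral_congr fun s hs => ?_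
    have hs' : s ∈ Set.Icc 0 X := Set.uIcc_subset_Icc hxs hy hs
    simp only [rateR, invWR, clampTo_of_mem hs', zero_mul, sub_zero, mul_one, mul_zero, add_zero]
    linear_combination s ^ 2 * two_mul_rpow_neg_half
  rw [angleR_of_mem hy, h, intervalIntegral.integral_const_mul, integral_pow, angleKepler]
  norm_num
  ring

theorem torqueR_zero {X xs z y : ℝ} (a b : ℝ → ℝ) (hxs : xs ∈ Set.Icc 0 X)
    (hy : y ∈ Set.Icc 0 X) : torqueR X xs 0 z a b y = √2 * (Real.sin (angleKepler xs z y) *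
      (1 - invDistR y (angleKepler xs z y))) := by
  simp only [torqueR, angleR_zero a b hxs hy, invWR, clampTo_of_mem hy, zero_mul, sub_zero,
    mul_one, mul_zero, add_zero]
  rw [← two_mul_rpow_neg_half]
  ring

theorem mul_integral_melCol_close {X xs m z c K : ℝ} {a b : ℝ → ℝ} (hxs : 0 < xs) (hX : xs < X)
    (hX1 : X < 1) (hm : 0 ≤ m)
    (h : |c - clampTo X xs *
      ∫ s in (0 : ℝ)..1, s ^ 4 * torqueR X xs 0 z a b (clampTo X xs * s)| ≤ K * m) :
    |m * (xs ^ 4 * c) - m * (xs ^ 2 * Real.cos z) -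
      m * ∫ s in tcol (xs ^ 2)..0, melCol (xs ^ 2) z s| ≤ K * m ^ 2 := by
  have hxs' : xs ∈ Set.Icc 0 X := ⟨hxs.le, hX.le⟩
  have hmel : ∫ s in tcol (xs ^ 2)..0, melCol (xs ^ 2) z s = xs ^ 4 * (clampTo X xs *
      ∫ s in (0 : ℝ)..1, s ^ 4 * torqueR X xs 0 z a b (clampTo X xs * s)) -
        xs ^ 2 * Real.cos z := by
    rw [integral_melCol hxs (hX.trans hX1), pow_four_mul_clampTo_mul_integral hxs']
    congr 1
    refine intervalIntegral.integral_congr fun y hy => ?_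
    rw [Set.uIcc_of_le hxs.le] at hy
    simp only [torqueR_zero a b hxs' ⟨hy.1, hy.2.trans hX.le⟩]
  have hxs4 : xs ^ 4 ≤ 1 := pow_le_one₀ hxs.le (hX.trans hX1).le
  rw [hmel, show ∀ A B D : ℝ, m * (xs ^ 4 * A) - m * D - m * (xs ^ 4 * B - D) =
    m * xs ^ 4 * (A - B) by intros; ring, abs_mul, abs_of_nonneg (by positivity)]
  calc _ ≤ m * 1 * (K * m) := by gcongr
    _ = K * m ^ 2 := by ring

/-- Parameterization, at the section `r = r*`, of the unstable manifold of collision: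
the orbits launched from `(r*, θ, R^u_{S⁺}(θ), Θ^u_{S⁺}(θ))` are ejection orbits, the
angular momentum `Θ^u_{S⁺}` is `μ`-close (up to `O(μ²)`) to an explicit Melnikov integral,
and by reversibility `θ ↦ (-R^u_{S⁺}(-θ), Θ^u_{S⁺}(-θ))` parameterizes collision orbits. -/
theorem collision_manifold_parametrization_at_section
    (rstar : ℝ) (hr : rstar ∈ Set.Ioo (0 : ℝ) 1) :
    ∃ μ₀ : ℝ, 0 < μ₀ ∧ ∃ C : ℝ, 0 < C ∧
      ∀ μ ∈ Set.Ioo (0 : ℝ) μ₀,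
        ∃ Ru Θu : ℝ → ℝ,
          ContDiff ℝ 1 Ru ∧ ContDiff ℝ 1 Θu ∧
          (∀ θ0 : ℝ, Ru (θ0 + 2 * π) = Ru θ0 ∧ Θu (θ0 + 2 * π) = Θu θ0) ∧
          -- ejection orbits
          (∀ θ0 : ℝ, ∃ tstar : ℝ, tstar < 0 ∧
            ∃ r θ R Θ : ℝ → ℝ,
              IsPolarSol μ (Set.Ioc tstar 0) r θ R Θ ∧
              r 0 = rstar ∧ θ 0 = θ0 ∧ R 0 = Ru θ0 ∧ Θ 0 = Θu θ0 ∧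
              Tendsto r (nhdsWithin tstar (Set.Ioi tstar)) (𝓝 0) ∧
              Tendsto R (nhdsWithin tstar (Set.Ioi tstar)) atTop) ∧
          -- asymptotic formula for Θ^u_{S⁺}
          (∀ θ0 : ℝ,
            |Θu θ0 - μ * ∫ s in (tcol rstar)..(0 : ℝ), melCol rstar θ0 s| ≤ C * μ ^ 2) ∧
          -- collision orbits by reversibility
          (∀ θ0 : ℝ, ∃ tstar : ℝ, 0 < tstar ∧
            ∃ r θ R Θ : ℝ → ℝ,
              IsPolarSol μ (Set.Ico 0 tstar) r θ R Θ ∧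
              r 0 = rstar ∧ θ 0 = θ0 ∧ R 0 = -Ru (-θ0) ∧ Θ 0 = Θu (-θ0) ∧
              Tendsto r (nhdsWithin tstar (Set.Iio tstar)) (𝓝 0) ∧
              Tendsto R (nhdsWithin tstar (Set.Iio tstar)) atBot) := by
  obtain ⟨xs, hxs, hxs1, rfl⟩ : ∃ xs : ℝ, 0 < xs ∧ xs < 1 ∧ xs ^ 2 = rstar :=
    ⟨√rstar, Real.sqrt_pos.2 hr.1, (Real.sqrt_lt_sqrt hr.1.le hr.2).trans_eq Real.sqrt_one,
      Real.sq_sqrt hr.1.le⟩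
  obtain ⟨X, δ, N, M, m0, S⟩ := exists_setting hxs hxs1
  refine ⟨m0, S.m0_pos, 2 * M / m0, div_pos (mul_pos two_pos S.M_pos) S.m0_pos, fun μ hμ => ?_⟩
  have habs : |μ| = μ := abs_of_pos hμ.1
  have hm : |μ| < m0 := habs.trans_lt hμ.2
  obtain ⟨a, b, hdiff, hab⟩ := S.exists_real_solution hm
  set Ru : ℝ → ℝ := fun z => √(2 * (1 - μ) + 2 * xs ^ 2 * (μ * b z xs)) / xs - μ * Real.sin z
    with hRu
  set Θu : ℝ → ℝ := fun z => μ * (xs ^ 4 * a z xs) - μ * (xs ^ 2 * Real.cos z) with hΘu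
  have hej : ∀ z : ℝ, ∃ tstar < 0, ∃ r θ R Θ : ℝ → ℝ,
      IsPolarSol μ (Set.Ioc tstar 0) r θ R Θ ∧ r 0 = xs ^ 2 ∧ θ 0 = z ∧ R 0 = Ru z ∧ Θ 0 = Θu z ∧
      Tendsto r (𝓝[>] tstar) (𝓝 0) ∧ Tendsto R (𝓝[>] tstar) atTop := by
    intro z
    obtain ⟨-, -, -, hbc, -, hbM, htc, hpc, hrc, ha, hb, -⟩ := hab z
    exact S.exists_ejection hm.le hbc hbM htc hpc hrc ha hb
  refine ⟨Ru, Θu, ?_, ?_, fun z => ?_, hej, fun z => ?_, fun z => ?_⟩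
  · refine ((ContDiff.sqrt ?_ fun z => ?_).div_const xs).sub (contDiff_const.mul Real.contDiff_sin)
    · exact contDiff_const.add (contDiff_const.mul (contDiff_const.mul (hdiff xs).2))
    · exact (zero_lt_one.trans_le (S.one_le_w hm.le ⟨hxs.le, S.xs_lt.le⟩
        (((hab z).2.2.2.2.2.1 xs).trans S.M_le_N))).ne'
  · exact (contDiff_const.mul (contDiff_const.mul (hdiff xs).1)).sub
      (contDiff_const.mul (contDiff_const.mul Real.contDiff_cos))
  · simp only [hRu, hΘu, (hab z).1, (hab z).2.1, Real.sin_add_two_pi, Real.cos_add_two_pi,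
      and_self]
  · obtain ⟨-, -, -, -, -, -, -, -, -, -, -, hclose⟩ := hab z
    exact mul_integral_melCol_close hxs S.xs_lt S.X_lt hμ.1.le ((hclose xs).trans_eq (by rw [habs]))
  · obtain ⟨tstar, ht, r, θ, R, Θ, hsol, hr0, hθ0, hR0, hΘ0, hrlim, hRlim⟩ := hej (-z)
    have hneg : Tendsto (fun t : ℝ => -t) (𝓝[<] (-tstar)) (𝓝[>] tstar) := by
      simpa using tendsto_neg_nhdsLT (a := -tstar)
    refine ⟨-tstar, neg_pos.2 ht, _, _, _, _, hsol.reverse, ?_, ?_, ?_, ?_, hrlim.comp hneg,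
      tendsto_neg_atTop_atBot.comp (hRlim.comp hneg)⟩
    · simpa using hr0
    · simp [hθ0]
    · simpa using hR0
    · simpa using hΘ0
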